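/- arXiv:2212.01797 — 6 statements merged into one kernel-verified Lean document; each statement's English description precedes it below -/
import Mathlib

section
/- Let a ≤ b be integers. There exists an integer l ≥ 0 depending only on b−a such that: for every commutative ring R, every π ∈ R, and every morphism α : M^• → N^• of cochain complexes of R-modules vanishing in degrees > b with H^i(α) a π-isomorphism for all i ≥ a, if N^• is π-[a,b]-pseudo-coherent then M^• is π^l-[a,b]-pseudo-coherent. -/
open CategoryTheory

section PseudoCoherence

variable {R : Type*} [CommRing R]

/-- A linear map (in `ModuleCat R`) is a `π`-isomorphism if its kernel and cokernel are
annihilated by `π`. -/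
def IsPiIsomorphism (π : R) {M N : ModuleCat R} (f : M ⟶ N) : Prop :=
  (∀ x : M, f x = 0 → π • x = 0) ∧ (∀ y : N, ∃ x : M, π • y = f x)

/-- A linear map (in `ModuleCat R`) is `π`-surjective if its cokernel is annihilated by `π`. -/
def IsPiSurjective (π : R) {M N : ModuleCat R} (f : M ⟶ N) : Prop :=
  ∀ y : N, ∃ x : M, π • y = f x

/-- A morphism of cochain complexes of `R`-modules `f : P^• ⟶ M^•` is a `π`-`[a,b]`-pseudo
resolution if `P^•` is a complex of finite free `R`-modules vanishing outside `[a,b]`, and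
`H^i(f)` is a `π`-isomorphism for `i > a` and `π`-surjective for `i = a`. -/
def IsPiPseudoResolution (π : R) (a b : ℤ) {P M : CochainComplex (ModuleCat R) ℤ}
    (f : P ⟶ M) : Prop :=
  (∀ i : ℤ, Module.Free R (P.X i)) ∧ (∀ i : ℤ, Module.Finite R (P.X i)) ∧
  (∀ i : ℤ, i < a ∨ b < i → ∀ x : P.X i, x = 0) ∧
  (∀ i : ℤ, a < i → IsPiIsomorphism π (HomologicalComplex.homologyMap f i)) ∧
  IsPiSurjective π (HomologicalComplex.homologyMap f a)

/-- A cochain complex of `R`-modules is `π`-`[a,b]`-pseudo-coherent if it vanishes in degrees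
`> b` and admits a `π`-`[a,b]`-pseudo resolution. -/
def IsPiPseudoCoherent (π : R) (a b : ℤ) (M : CochainComplex (ModuleCat R) ℤ) : Prop :=
  (∀ i : ℤ, b < i → ∀ x : M.X i, x = 0) ∧
  ∃ (P : CochainComplex (ModuleCat R) ℤ) (f : P ⟶ M), IsPiPseudoResolution π a b f

end PseudoCoherence

section Helpers

variable {R : Type*} [CommRing R]

lemma psc_boundary_iff (K : CochainComplex (ModuleCat R) ℤ) (i : ℤ) (z : K.cycles i) :
    K.homologyπ i z = 0 ↔ ∃ w : K.X (i - 1), K.iCycles i z = K.d (i - 1) i w := by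
  have h1 : K.homologyι i (K.homologyπ i z) = K.pOpcycles i (K.iCycles i z) := by
    rw [← ConcreteCategory.comp_apply, ← ConcreteCategory.comp_apply, K.homology_π_ι]
  have h2 : K.homologyπ i z = 0 ↔ K.homologyι i (K.homologyπ i z) = 0 := by
    refine ⟨fun h => by rw [h, map_zero], fun h => ?_⟩
    exact (ModuleCat.mono_iff_injective (K.homologyι i)).1 inferInstance (by rw [h, map_zero])
  rw [h2, h1]
  have h3 := (K.sc i).moduleCat_pOpcycles_eq_zero_iff (K.iCycles i z)
  have h4 : (ComplexShape.up ℤ).prev i = i - 1 := by simp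
  refine Iff.trans h3 ?_
  rw [← h4]
  constructor
  · rintro ⟨w, hw⟩
    exact ⟨w, hw.symm⟩
  · rintro ⟨w, hw⟩
    exact ⟨w, hw.symm⟩

lemma psc_d_iCycles (K : CochainComplex (ModuleCat R) ℤ) (i : ℤ) (z : K.cycles i) :
    K.d i (i + 1) (K.iCycles i z) = 0 := by
  rw [← ConcreteCategory.comp_apply, K.iCycles_d]
  rfl

lemma psc_exists_cycle (K : CochainComplex (ModuleCat R) ℤ) (i : ℤ) (x : K.X i)
    (hx : K.d i (i + 1) x = 0) : ∃ z : K.cycles i, K.iCycles i z = x :=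
  ⟨K.cyclesMk x (i + 1) (by simp) hx, K.i_cyclesMk x (i + 1) (by simp) hx⟩

lemma psc_homologyπ_surj (K : CochainComplex (ModuleCat R) ℤ) (i : ℤ) (y : K.homology i) :
    ∃ z : K.cycles i, K.homologyπ i z = y :=
  (ModuleCat.epi_iff_surjective (K.homologyπ i)).1 inferInstance y

lemma psc_map_π {K L : CochainComplex (ModuleCat R) ℤ} (φ : K ⟶ L) (i : ℤ) (z : K.cycles i) :
    HomologicalComplex.homologyMap φ i (K.homologyπ i z) =
      L.homologyπ i (HomologicalComplex.cyclesMap φ i z) := by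
  rw [← ConcreteCategory.comp_apply, ← ConcreteCategory.comp_apply,
    HomologicalComplex.homologyπ_naturality]

lemma psc_map_i {K L : CochainComplex (ModuleCat R) ℤ} (φ : K ⟶ L) (i : ℤ) (z : K.cycles i) :
    L.iCycles i (HomologicalComplex.cyclesMap φ i z) = φ.f i (K.iCycles i z) := by
  rw [← ConcreteCategory.comp_apply, ← ConcreteCategory.comp_apply,
    HomologicalComplex.cyclesMap_i]

lemma psc_ker_iff (c : R) {K L : CochainComplex (ModuleCat R) ℤ} (φ : K ⟶ L) (i : ℤ) :
    (∀ x : K.homology i, HomologicalComplex.homologyMap φ i x = 0 → c • x = 0) ↔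
    ∀ x : K.X i, K.d i (i + 1) x = 0 → (∃ w : L.X (i - 1), φ.f i x = L.d (i - 1) i w) →
      ∃ v : K.X (i - 1), c • x = K.d (i - 1) i v := by
  constructor
  · intro h x hx hw
    obtain ⟨z, rfl⟩ := psc_exists_cycle K i x hx
    have := h (K.homologyπ i z) (by
      rw [psc_map_π, psc_boundary_iff, psc_map_i]; exact hw)
    rw [← map_smul, psc_boundary_iff, map_smul] at this
    exact this
  · intro h y hy
    obtain ⟨z, rfl⟩ := psc_homologyπ_surj K i y
    rw [psc_map_π, psc_boundary_iff, psc_map_i] at hy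
    rw [← map_smul, psc_boundary_iff, map_smul]
    exact h _ (psc_d_iCycles K i z) hy

lemma psc_surj_iff (c : R) {K L : CochainComplex (ModuleCat R) ℤ} (φ : K ⟶ L) (i : ℤ) :
    (∀ y : L.homology i, ∃ x : K.homology i,
      c • y = HomologicalComplex.homologyMap φ i x) ↔
    ∀ y : L.X i, L.d i (i + 1) y = 0 → ∃ (x : K.X i) (w : L.X (i - 1)),
      K.d i (i + 1) x = 0 ∧ c • y = φ.f i x + L.d (i - 1) i w := by
  have key : ∀ (z : L.cycles i) (t : K.cycles i),
      c • L.homologyπ i z = HomologicalComplex.homologyMap φ i (K.homologyπ i t) ↔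
      ∃ w : L.X (i - 1), c • L.iCycles i z = φ.f i (K.iCycles i t) + L.d (i - 1) i w := by
    intro z t
    rw [psc_map_π, ← map_smul, ← sub_eq_zero, ← map_sub, psc_boundary_iff, map_sub, map_smul,
      psc_map_i]
    simp only [sub_eq_iff_eq_add']
  constructor
  · intro h y hy
    obtain ⟨z, rfl⟩ := psc_exists_cycle L i y hy
    obtain ⟨x, hx⟩ := h (L.homologyπ i z)
    obtain ⟨t, rfl⟩ := psc_homologyπ_surj K i x
    obtain ⟨w, hw⟩ := (key z t).1 hx
    exact ⟨_, w, psc_d_iCycles K i t, hw⟩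
  · intro h y
    obtain ⟨z, rfl⟩ := psc_homologyπ_surj L i y
    obtain ⟨x, w, hx, hw⟩ := h _ (psc_d_iCycles L i z)
    obtain ⟨t, rfl⟩ := psc_exists_cycle K i x hx
    exact ⟨_, (key z t).2 ⟨w, hw⟩⟩

lemma psc_dd (K : CochainComplex (ModuleCat R) ℤ) (i j k : ℤ) (x : K.X i) :
    K.d j k (K.d i j x) = 0 := by
  rw [← ConcreteCategory.comp_apply, K.d_comp_d]
  rfl

lemma psc_comm {K L : CochainComplex (ModuleCat R) ℤ} (φ : K ⟶ L) (i j : ℤ) (x : K.X i) :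
    φ.f j (K.d i j x) = L.d i j (φ.f i x) := by
  rw [← ConcreteCategory.comp_apply, ← ConcreteCategory.comp_apply, φ.comm]

/-- one lifting step on a free module -/
lemma psc_step (π : R) {M N P : CochainComplex (ModuleCat R) ℤ} (α : M ⟶ N) (j : ℤ)
    [Module.Free R (P.X j)]
    (hinj : ∀ x : M.X (j + 1), M.d (j + 1) (j + 1 + 1) x = 0 →
      (∃ w : N.X (j + 1 - 1), α.f (j + 1) x = N.d (j + 1 - 1) (j + 1) w) →
      ∃ v : M.X (j + 1 - 1), π • x = M.d (j + 1 - 1) (j + 1) v)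
    (hsurj : ∀ y : N.X j, N.d j (j + 1) y = 0 → ∃ (x : M.X j) (w : N.X (j - 1)),
      M.d j (j + 1) x = 0 ∧ π • y = α.f j x + N.d (j - 1) j w)
    (u : P.X j →ₗ[R] M.X (j + 1)) (v : P.X j →ₗ[R] N.X j)
    (hu : ∀ x, M.d (j + 1) (j + 1 + 1) (u x) = 0)
    (huv : ∀ x, α.f (j + 1) (u x) = N.d j (j + 1) (v x)) :
    ∃ (g : P.X j →ₗ[R] M.X j) (h : P.X j →ₗ[R] N.X (j - 1)),
      (∀ x, M.d j (j + 1) (g x) = π ^ 2 • u x) ∧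
      (∀ x, α.f j (g x) = π ^ 2 • v x + N.d (j - 1) j (h x)) := by
  have hj : j + 1 - 1 = j := by ring
  rw [hj] at hinj
  have key : ∀ x : P.X j, ∃ (m : M.X j) (n : N.X (j - 1)),
      M.d j (j + 1) m = π ^ 2 • u x ∧ α.f j m = π ^ 2 • v x + N.d (j - 1) j n := by
    intro x
    obtain ⟨m1, hm1⟩ := hinj (u x) (hu x) ⟨v x, huv x⟩
    obtain ⟨m2, n, hm2, hn⟩ := hsurj (α.f j m1 - π • v x) (by
      rw [map_sub, ← psc_comm, ← hm1, map_smul, map_smul, huv, sub_self])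
    refine ⟨π • m1 - m2, n, ?_, ?_⟩
    · rw [map_sub, map_smul, ← hm1, hm2, sub_zero, smul_smul, sq]
    · rw [map_sub, map_smul, sub_eq_iff_eq_add, add_assoc, add_comm (N.d _ _ _), ← hn, smul_sub,
        smul_smul, sq]
      abel
  choose m n hm hn using key
  let b := Module.Free.chooseBasis R (P.X j)
  refine ⟨b.constr R (fun i => m (b i)), b.constr R (fun i => n (b i)), ?_, ?_⟩
  · have : (M.d j (j + 1)).hom ∘ₗ b.constr R (fun i => m (b i)) = π ^ 2 • u := by
      refine b.ext fun i => ?_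
      simpa using hm (b i)
    exact fun x => LinearMap.congr_fun this x
  · have : (α.f j).hom ∘ₗ b.constr R (fun i => m (b i)) =
        π ^ 2 • v + (N.d (j - 1) j).hom ∘ₗ b.constr R (fun i => n (b i)) := by
      refine b.ext fun i => ?_
      simpa using hn (b i)
    exact fun x => LinearMap.congr_fun this x

lemma psc_lift (π : R) (a b : ℤ) {M N P : CochainComplex (ModuleCat R) ℤ} (α : M ⟶ N)
    (f : P ⟶ N) (hfree : ∀ i : ℤ, Module.Free R (P.X i))
    (hP : ∀ i : ℤ, b < i → ∀ x : P.X i, x = 0)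
    (hα : ∀ i : ℤ, a ≤ i → IsPiIsomorphism π (HomologicalComplex.homologyMap α i)) (n : ℕ)
    (hn : (n : ℤ) ≤ b + 1 - a) :
    ∃ (g : ∀ i, P.X i →ₗ[R] M.X i) (h : ∀ i j, P.X i →ₗ[R] N.X j),
      ∀ i, b + 1 - n ≤ i → ∀ x : P.X i,
        M.d i (i + 1) (g i x) = g (i + 1) (P.d i (i + 1) x) ∧
        α.f i (g i x) = π ^ (2 * n) • f.f i x + N.d (i - 1) i (h i (i - 1) x) +
          h (i + 1) i (P.d i (i + 1) x) := by
  induction n with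
  | zero =>
    refine ⟨fun _ => 0, fun _ _ => 0, fun i hi x => ?_⟩
    rw [hP i (by simp at hi; omega) x]
    simp
  | succ n ih =>
    obtain ⟨g, h, hgh⟩ := ih (by push_cast at hn; omega)
    obtain ⟨j, hj⟩ : ∃ j, j = b - n := ⟨_, rfl⟩
    have := hfree j
    obtain ⟨g', h', hg', hh'⟩ := psc_step π (P := P) α j
      ((psc_ker_iff π α (j + 1)).1 (hα (j + 1) (by push_cast at hn; omega)).1)
      ((psc_surj_iff π α j).1 (hα j (by push_cast at hn; omega)).2)
      (g (j + 1) ∘ₗ (P.d j (j + 1)).hom)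
      (π ^ (2 * n) • (f.f j).hom + h (j + 1) j ∘ₗ (P.d j (j + 1)).hom)
      (by
        intro x
        have := (hgh (j + 1) (by omega) (P.d j (j + 1) x)).1
        rw [psc_dd, map_zero] at this
        exact this)
      (by
        intro x
        have := (hgh (j + 1) (by omega) (P.d j (j + 1) x)).2
        have e : j + 1 - 1 = j := by ring
        rw [psc_dd, map_zero, add_zero, e, psc_comm] at this
        refine Eq.trans this ?_
        simp)
    refine ⟨Function.update (fun i => π ^ 2 • g i) j g',
      Function.update (fun i k => π ^ 2 • h i k) j (Function.update (fun _ => 0) (j - 1) h'), ?_⟩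
    intro i hi x
    push_cast at hi
    by_cases hij : i = j
    · subst hij
      have e : i + 1 ≠ i := by omega
      simp only [Function.update_self, Function.update_of_ne e]
      refine ⟨hg' x, (hh' x).trans ?_⟩
      simp only [LinearMap.add_apply, LinearMap.smul_apply, LinearMap.comp_apply, smul_add,
        smul_smul]
      rw [show π ^ (2 * (n + 1)) = π ^ 2 * π ^ (2 * n) by ring]
      exact add_right_comm _ _ _
    · have e : i + 1 ≠ j := by omega
      simp only [Function.update_of_ne e, Function.update_of_ne hij]
      obtain ⟨h1, h2⟩ := hgh i (by omega) x
      simp only [LinearMap.smul_apply, map_smul, h1, h2, smul_add, smul_smul]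
      rw [show π ^ (2 * (n + 1)) = π ^ 2 * π ^ (2 * n) by ring]
      simp

end Helpers

universe u

/-- **Lemma 4.3(2).** There is an integer `l ≥ 0` depending only on `b - a` such that: for
every commutative ring `R`, every `π ∈ R`, and every morphism `α : M^• ⟶ N^•` of cochain
complexes of `R`-modules vanishing in degrees `> b`, inducing a `π`-isomorphism `H^i(α)`
for all `i ≥ a`, if `N^•` is `π`-`[a,b]`-pseudo-coherent then `M^•` is
`π^l`-`[a,b]`-pseudo-coherent. -/
theorem isPiPseudoCoherent_of_pi_iso_inverse :
    ∃ l : ℤ → ℕ, ∀ (a b : ℤ), a ≤ b →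
      ∀ (R : Type u) [CommRing R] (π : R) (M N : CochainComplex (ModuleCat R) ℤ)
        (α : M ⟶ N),
        (∀ i : ℤ, b < i → ∀ x : M.X i, x = 0) →
        (∀ i : ℤ, b < i → ∀ x : N.X i, x = 0) →
        (∀ i : ℤ, a ≤ i → IsPiIsomorphism π (HomologicalComplex.homologyMap α i)) →
        IsPiPseudoCoherent π a b N →
        IsPiPseudoCoherent (π ^ l (b - a)) a b M := by
  refine ⟨fun t => 2 * (t + 1).toNat + 2, ?_⟩
  intro a b hab R _ π M N α hM hN hα ⟨_, P, f, hfree, hfin, hP, hiso, hsurj⟩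
  refine ⟨hM, P, ?_⟩
  obtain ⟨n, hn⟩ : ∃ n : ℕ, n = (b - a + 1).toNat := ⟨_, rfl⟩
  simp only [← hn]
  obtain ⟨g, h, hgh⟩ := psc_lift π a b α f hfree (fun i hi => hP i (Or.inr hi)) hα n (by omega)
  let G : P ⟶ M :=
    { f := fun i => ModuleCat.ofHom (g i)
      comm' := by
        rintro i j (rfl : i + 1 = j)
        ext x
        by_cases hi : a ≤ i
        · exact (hgh i (by omega) x).1
        · rw [hP i (Or.inl (by omega)) x, map_zero, map_zero] }
  have hG : ∀ i x, G.f i x = g i x := fun i x => rfl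
  -- on cocycles, `α ∘ G` and `π ^ (2 n) f` differ by a coboundary
  have hcyc : ∀ i, a ≤ i → ∀ x : P.X i, P.d i (i + 1) x = 0 → ∃ w : N.X (i - 1),
      α.f i (G.f i x) = π ^ (2 * n) • f.f i x + N.d (i - 1) i w := by
    intro i hi x hx
    refine ⟨h i (i - 1) x, ?_⟩
    have := (hgh i (by omega) x).2
    rw [hx, map_zero, add_zero] at this
    exact this
  have hS : ∀ i, a ≤ i → IsPiSurjective π (HomologicalComplex.homologyMap f i) →
      IsPiSurjective (π ^ (2 * n + 2)) (HomologicalComplex.homologyMap G i) := by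
    intro i hi hs
    refine (psc_surj_iff _ G i).2 fun y hy => ?_
    obtain ⟨x, w, hx, hw⟩ := (psc_surj_iff _ f i).1 hs (α.f i y) (by
      rw [← psc_comm, hy, map_zero])
    obtain ⟨w', hw'⟩ := hcyc i hi x hx
    obtain ⟨v, hv⟩ := (psc_ker_iff _ α i).1 (hα i hi).1 (π ^ (2 * n + 1) • y - G.f i x) (by
      rw [map_sub, map_smul, hy, ← psc_comm, hx, map_zero, smul_zero, sub_zero])
      ⟨π ^ (2 * n) • w - w', by
        rw [map_sub, map_smul, hw', pow_succ, mul_smul, hw, map_sub, map_smul, smul_add]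
        abel⟩
    refine ⟨π • x, v, by rw [map_smul, hx, smul_zero], ?_⟩
    rw [← hv, map_smul, smul_sub, smul_smul, ← pow_succ']
    abel
  refine ⟨G, hfree, hfin, hP, fun i hi => ⟨?_, ?_⟩, hS a le_rfl hsurj⟩
  · refine (psc_ker_iff _ G i).2 fun x hx ⟨w, hw⟩ => ?_
    obtain ⟨w', hw'⟩ := hcyc i hi.le x hx
    obtain ⟨v, hv⟩ := (psc_ker_iff _ f i).1 (hiso i hi).1 (π ^ (2 * n) • x) (by
      rw [map_smul, hx, smul_zero]) ⟨α.f (i - 1) w - w', by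
        rw [map_smul, map_sub, ← psc_comm, ← hw, hw']
        abel⟩
    refine ⟨π • v, ?_⟩
    rw [map_smul, ← hv, smul_smul, smul_smul]
    congr 1
    ring
  · exact hS i hi.le (hiso i hi).2
end

section
/- Let a ≤ b be integers. There exists an integer l ≥ 0 depending only on b−a such that: for every commutative ring R, every π ∈ R, and every distinguished triangle M_1^• → M_2^• → M_3^• → M_1^•[1] in the homotopy category K(R) of cochain complexes of R-modules, if M_1^• is π-[a+1,b+1]-pseudo-coherent, M_2^• is π-[a,b]-pseudo-coherent, and M_3^i = 0 for all i > b, then M_3^• is π^l-[a,b]-pseudo-coherent. -/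
open CategoryTheory

universe u

open CategoryTheory.Pretriangulated

open CategoryTheory.Limits HomologicalComplex

section Helpers

universe v w

variable {R : Type u} [CommRing R]

/-- The homology functor on the homotopy category. -/
noncomputable abbrev kH (R : Type u) [CommRing R] (n : ℤ) :
    HomotopyCategory (ModuleCat.{v} R) (ComplexShape.up ℤ) ⥤ ModuleCat.{v} R :=
  (HomotopyCategory.homologyFunctor (ModuleCat.{v} R) (ComplexShape.up ℤ) 0).shift n

noncomputable abbrev kQ (R : Type u) [CommRing R] :
    CochainComplex (ModuleCat.{v} R) ℤ ⥤
      HomotopyCategory (ModuleCat.{v} R) (ComplexShape.up ℤ) :=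
  HomotopyCategory.quotient (ModuleCat.{v} R) (ComplexShape.up ℤ)

lemma isPiSurjective_of_conj (π : R) {A B A' B' : ModuleCat.{v} R} {f : A ⟶ B} {f' : A' ⟶ B'}
    (e₁ : A ≅ A') (e₂ : B ≅ B') (h : f ≫ e₂.hom = e₁.hom ≫ f')
    (hf : IsPiSurjective π f) : IsPiSurjective π f' := by
  intro y
  obtain ⟨x, hx⟩ := hf (e₂.inv y)
  refine ⟨e₁.hom x, ?_⟩
  have h1 := ConcreteCategory.congr_hom h x
  simp only [ConcreteCategory.comp_apply] at h1
  rw [← h1, ← hx, map_smul]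
  simp

lemma isPiIsomorphism_of_conj (π : R) {A B A' B' : ModuleCat.{v} R} {f : A ⟶ B} {f' : A' ⟶ B'}
    (e₁ : A ≅ A') (e₂ : B ≅ B') (h : f ≫ e₂.hom = e₁.hom ≫ f')
    (hf : IsPiIsomorphism π f) : IsPiIsomorphism π f' := by
  refine ⟨fun x hx => ?_, isPiSurjective_of_conj π e₁ e₂ h hf.2⟩
  have h1 := ConcreteCategory.congr_hom h (e₁.inv x)
  simp only [ConcreteCategory.comp_apply] at h1
  have h2 : f (e₁.inv x) = 0 := by
    have : e₂.inv (e₂.hom (f (e₁.inv x))) = e₂.inv (f' (e₁.hom (e₁.inv x))) := by rw [h1]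
    simpa [hx] using this
  have h3 := congrArg e₁.hom (hf.1 _ h2)
  simpa using h3

lemma isPiIsomorphism_kH_iff (π : R) {K L : CochainComplex (ModuleCat.{v} R) ℤ} (f : K ⟶ L)
    (n : ℤ) : IsPiIsomorphism π ((kH R n).map ((kQ R).map f)) ↔
      IsPiIsomorphism π (homologyMap f n) := by
  have e := HomotopyCategory.homologyFunctorFactors (ModuleCat.{v} R) (ComplexShape.up ℤ) n
  exact ⟨isPiIsomorphism_of_conj π (e.app K) (e.app L) (e.hom.naturality f),
    isPiIsomorphism_of_conj π (e.symm.app K) (e.symm.app L) (e.inv.naturality f)⟩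

lemma isPiSurjective_kH_iff (π : R) {K L : CochainComplex (ModuleCat.{v} R) ℤ} (f : K ⟶ L)
    (n : ℤ) : IsPiSurjective π ((kH R n).map ((kQ R).map f)) ↔
      IsPiSurjective π (homologyMap f n) := by
  have e := HomotopyCategory.homologyFunctorFactors (ModuleCat.{v} R) (ComplexShape.up ℤ) n
  exact ⟨isPiSurjective_of_conj π (e.app K) (e.app L) (e.hom.naturality f),
    isPiSurjective_of_conj π (e.symm.app K) (e.symm.app L) (e.inv.naturality f)⟩

lemma killed_of_iso (π : R) {A B : ModuleCat.{v} R} (e : A ≅ B) (h : ∀ x : A, π • x = 0)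
    (y : B) : π • y = 0 := by
  have h' := congrArg e.hom (h (e.inv y))
  simpa using h'

lemma exact_apply {A B C : ModuleCat.{v} R} {f : A ⟶ B} {g : B ⟶ C} {h : f ≫ g = 0}
    (hex : (ShortComplex.mk f g h).Exact) (x : B) (hx : g x = 0) : ∃ y : A, f y = x :=
  (ShortComplex.moduleCat_exact_iff _).1 hex x hx

lemma zero_apply' {A B C : ModuleCat.{v} R} {f : A ⟶ B} {g : B ⟶ C} (h : f ≫ g = 0) (x : A) :
    g (f x) = 0 := by
  have := ConcreteCategory.congr_hom h x
  simpa using this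

lemma comm_apply' {A B C D : ModuleCat.{v} R} {f : A ⟶ B} {g : B ⟶ D} {f' : A ⟶ C} {g' : C ⟶ D}
    (h : f ≫ g = f' ≫ g') (x : A) : g (f x) = g' (f' x) := by
  have := ConcreteCategory.congr_hom h x
  simpa using this

/-- Cone of a pseudo resolution has homology killed by `π ^ 2`. -/
lemma cone_homology_killed (π : R) (T : Triangle (HomotopyCategory (ModuleCat.{v} R)
      (ComplexShape.up ℤ))) (hT : T ∈ distTriang _) (n m : ℤ) (hnm : n + 1 = m)
    (h1 : IsPiSurjective π ((kH R n).map T.mor₁))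
    (h2 : IsPiIsomorphism π ((kH R m).map T.mor₁))
    (x : (kH R n).obj T.obj₃) : (π ^ 2) • x = 0 := by
  let F := HomotopyCategory.homologyFunctor (ModuleCat.{v} R) (ComplexShape.up ℤ) 0
  have a1 := h2.1 _ (zero_apply' (F.homologySequenceδ_comp T hT n m hnm) x)
  rw [← map_smul] at a1
  obtain ⟨y, hy⟩ := exact_apply (F.homologySequence_exact₃ T hT n m hnm) _ a1
  obtain ⟨z, hz⟩ := h1 y
  rw [pow_two, mul_smul, ← hy, ← map_smul, hz]
  exact zero_apply' (F.homologySequence_comp T hT n) z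

lemma five_surj (ρ : R) (T T' : Triangle (HomotopyCategory (ModuleCat.{v} R)
      (ComplexShape.up ℤ))) (hT : T ∈ distTriang _) (hT' : T' ∈ distTriang _) (φ : T ⟶ T')
    (n m : ℤ) (hnm : n + 1 = m)
    (h2 : IsPiSurjective ρ ((kH R n).map φ.hom₂))
    (h1 : IsPiSurjective ρ ((kH R m).map φ.hom₁))
    (h2' : IsPiIsomorphism ρ ((kH R m).map φ.hom₂)) :
    IsPiSurjective (ρ ^ 3) ((kH R n).map φ.hom₃) := by
  let F := HomotopyCategory.homologyFunctor (ModuleCat.{v} R) (ComplexShape.up ℤ) 0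
  have cδ := F.homologySequenceδ_naturality T T' φ n m hnm
  have cu : (kH R m).map T.mor₁ ≫ (kH R m).map φ.hom₂ =
      (kH R m).map φ.hom₁ ≫ (kH R m).map T'.mor₁ := by
    rw [← Functor.map_comp, ← Functor.map_comp, φ.comm₁]
  have cv : (kH R n).map T.mor₂ ≫ (kH R n).map φ.hom₃ =
      (kH R n).map φ.hom₂ ≫ (kH R n).map T'.mor₂ := by
    rw [← Functor.map_comp, ← Functor.map_comp, φ.comm₂]
  intro y
  obtain ⟨p1, hp1⟩ := h1 (F.homologySequenceδ T' n m hnm y)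
  have e1 : (kH R m).map φ.hom₂ ((kH R m).map T.mor₁ p1) = 0 := by
    rw [comm_apply' cu, ← hp1, map_smul]
    erw [zero_apply' (F.homologySequenceδ_comp T' hT' n m hnm) y]
    simp
  have e2 := h2'.1 _ e1
  rw [← map_smul] at e2
  obtain ⟨p3, hp3⟩ := exact_apply (F.homologySequence_exact₁ T hT n m hnm) _ e2
  have e3 : F.homologySequenceδ T' n m hnm (ρ ^ 2 • y - (kH R n).map φ.hom₃ p3) = 0 := by
    have := comm_apply' cδ p3
    rw [map_sub, map_smul]
    erw [this, hp3]
    rw [map_smul, ← hp1, smul_smul, ← pow_two, sub_self]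
  obtain ⟨m2, hm2⟩ := exact_apply (F.homologySequence_exact₃ T' hT' n m hnm) _ e3
  obtain ⟨p2, hp2⟩ := h2 m2
  refine ⟨ρ • p3 + (kH R n).map T.mor₂ p2, ?_⟩
  rw [map_add, comm_apply' cv, ← hp2, map_smul, map_smul]
  erw [hm2]
  rw [smul_sub, smul_smul, ← pow_succ']
  abel

lemma five_inj (ρ : R) (T T' : Triangle (HomotopyCategory (ModuleCat.{v} R)
      (ComplexShape.up ℤ))) (hT : T ∈ distTriang _) (hT' : T' ∈ distTriang _) (φ : T ⟶ T')
    (n m : ℤ) (hnm : n + 1 = m)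
    (h1 : IsPiSurjective ρ ((kH R n).map φ.hom₁))
    (h2 : IsPiIsomorphism ρ ((kH R n).map φ.hom₂))
    (h1' : IsPiIsomorphism ρ ((kH R m).map φ.hom₁))
    (x : (kH R n).obj T.obj₃) (hx : (kH R n).map φ.hom₃ x = 0) : (ρ ^ 3) • x = 0 := by
  let F := HomotopyCategory.homologyFunctor (ModuleCat.{v} R) (ComplexShape.up ℤ) 0
  have cδ := F.homologySequenceδ_naturality T T' φ n m hnm
  have cu : (kH R n).map T.mor₁ ≫ (kH R n).map φ.hom₂ =
      (kH R n).map φ.hom₁ ≫ (kH R n).map T'.mor₁ := by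
    rw [← Functor.map_comp, ← Functor.map_comp, φ.comm₁]
  have cv : (kH R n).map T.mor₂ ≫ (kH R n).map φ.hom₃ =
      (kH R n).map φ.hom₂ ≫ (kH R n).map T'.mor₂ := by
    rw [← Functor.map_comp, ← Functor.map_comp, φ.comm₂]
  have e1 : (kH R m).map φ.hom₁ (F.homologySequenceδ T n m hnm x) = 0 := by
    have := comm_apply' cδ x
    erw [hx] at this
    rw [map_zero] at this
    exact this.symm
  have e2 := h1'.1 _ e1
  rw [← map_smul] at e2
  obtain ⟨p2, hp2⟩ := exact_apply (F.homologySequence_exact₃ T hT n m hnm) _ e2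
  have hp2' : (kH R n).map T.mor₂ p2 = ρ • x := hp2
  have e3 : (kH R n).map T'.mor₂ ((kH R n).map φ.hom₂ p2) = 0 := by
    rw [← comm_apply' cv, hp2', map_smul, hx, smul_zero]
  obtain ⟨m1, hm1⟩ := exact_apply (F.homologySequence_exact₂ T' hT' n) _ e3
  have hm1' : (kH R n).map T'.mor₁ m1 = (kH R n).map φ.hom₂ p2 := hm1
  obtain ⟨p1, hp1⟩ := h1 m1
  have e4 : (kH R n).map φ.hom₂ (ρ • p2 - (kH R n).map T.mor₁ p1) = 0 := by
    rw [map_sub, map_smul, comm_apply' cu, ← hp1, map_smul, hm1', sub_self]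
  have e5 := h2.1 _ e4
  rw [smul_sub, sub_eq_zero] at e5
  have e6 := congrArg ((kH R n).map T.mor₂) e5
  have e7 : (kH R n).map T.mor₂ ((kH R n).map T.mor₁ p1) = 0 :=
    zero_apply' (F.homologySequence_comp T hT n) p1
  rw [map_smul, map_smul, map_smul, e7, hp2', smul_zero] at e6
  rw [← e6, smul_smul, smul_smul]
  congr 1
  ring

lemma cycles_smul_boundary (σ : R) (C : CochainComplex (ModuleCat.{v} R) ℤ) (i j k : ℤ)
    (hij : i + 1 = j) (hjk : j + 1 = k)
    (hσ : ∀ x : C.homology j, σ • x = 0) (z : C.X j) (hz : C.d j k z = 0) :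
    ∃ y : C.X i, C.d i j y = σ • z := by
  have ex1 := ShortComplex.exact_of_f_is_kernel (ShortComplex.mk _ _ (C.iCycles_d j k))
    (C.cyclesIsKernel j k (by simp [hjk]))
  have ex2 := ShortComplex.exact_of_g_is_cokernel
    (ShortComplex.mk _ _ (C.toCycles_comp_homologyπ i j))
    (C.homologyIsCokernel i j (by simp [← hij]))
  obtain ⟨c, hc⟩ := exact_apply ex1 z hz
  have h0 : C.homologyπ j (σ • c) = 0 := by rw [map_smul]; exact hσ _
  obtain ⟨y, hy⟩ := exact_apply ex2 _ h0
  refine ⟨y, ?_⟩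
  rw [← C.toCycles_i i j, ConcreteCategory.comp_apply, hy, map_smul, hc]

lemma IsPiSurjective.mul_left {π : R} {A B : ModuleCat.{v} R} {f : A ⟶ B}
    (hf : IsPiSurjective π f) (τ : R) : IsPiSurjective (τ * π) f := by
  intro y
  obtain ⟨x, hx⟩ := hf y
  exact ⟨τ • x, by rw [mul_smul, hx, map_smul]⟩

lemma IsPiIsomorphism.mul_left {π : R} {A B : ModuleCat.{v} R} {f : A ⟶ B}
    (hf : IsPiIsomorphism π f) (τ : R) : IsPiIsomorphism (τ * π) f :=
  ⟨fun x hx => by rw [mul_smul, hf.1 x hx, smul_zero], IsPiSurjective.mul_left hf.2 τ⟩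

lemma IsPiSurjective.smul_map {π : R} {A B : ModuleCat.{v} R} {f : A ⟶ B}
    (hf : IsPiSurjective π f) (τ : R) : IsPiSurjective (τ * π) (τ • f) := by
  intro y
  obtain ⟨x, hx⟩ := hf y
  exact ⟨x, by rw [mul_smul, hx]; rfl⟩

lemma IsPiIsomorphism.smul_map {π : R} {A B : ModuleCat.{v} R} {f : A ⟶ B}
    (hf : IsPiIsomorphism π f) (τ : R) : IsPiIsomorphism (τ * π) (τ • f) := by
  refine ⟨fun x hx => ?_, IsPiSurjective.smul_map hf.2 τ⟩
  have h : f (τ • x) = 0 := by rw [map_smul]; exact hx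
  rw [mul_comm, mul_smul]
  exact hf.1 _ h

lemma homologyMap_smul' {K L : CochainComplex (ModuleCat.{v} R) ℤ} (τ : R) (f : K ⟶ L) (n : ℤ) :
    homologyMap (τ • f) n = τ • homologyMap f n :=
  ShortComplex.homologyMap_smul ((shortComplexFunctor _ _ n).map f) τ

/-- The terms of a mapping cone. -/
noncomputable def coneEquiv {K L : CochainComplex (ModuleCat.{v} R) ℤ} (f : K ⟶ L) (i : ℤ) :
    (CochainComplex.mappingCone f).X i ≃ₗ[R] (K.X (i + 1) × L.X i) :=
  (homotopyCofiber.XIsoBiprod f i (i + 1) rfl ≪≫ ModuleCat.biprodIsoProd _ _).toLinearEquiv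

/-- One step of the inductive construction of a homotopy. -/
lemma homotopy_step (σ : R) (P C : CochainComplex (ModuleCat.{v} R) ℤ) (m : ℤ)
    (hfree : Module.Free R (P.X m)) (hσ : ∀ x : C.homology m, σ • x = 0)
    (g : P ⟶ C) (hg : ∀ i, m < i → g.f i = 0) :
    ∃ g' : P ⟶ C, (∀ i, m - 1 < i → g'.f i = 0) ∧
      (kQ R).map (σ • g) = (kQ R).map g' := by
  have hcyc : ∀ z : P.X m, C.d m (m + 1) (g.f m z) = 0 := by
    intro z
    rw [comm_apply' (g.comm m (m + 1)), hg (m + 1) (by lia)]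
    simp
  let dl : C.X (m - 1) →ₗ[R] C.X m := (C.d (m - 1) m).hom
  have hr : ∀ z : P.X m, (σ • (g.f m).hom) z ∈ LinearMap.range dl := by
    intro z
    obtain ⟨y, hy⟩ := cycles_smul_boundary σ C (m - 1) m (m + 1) (by lia) rfl hσ _ (hcyc z)
    exact ⟨y, hy⟩
  obtain ⟨h, hh⟩ := Module.projective_lifting_property dl.rangeRestrict
    (LinearMap.codRestrict _ (σ • (g.f m).hom) hr) dl.surjective_rangeRestrict
  have hh' : ModuleCat.ofHom h ≫ C.d (m - 1) m = σ • g.f m := by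
    ext z
    have := congrArg Subtype.val (LinearMap.congr_fun hh z)
    exact this
  let hom : ∀ i j, (ComplexShape.up ℤ).Rel j i → (P.X i ⟶ C.X j) := fun i j hij =>
    if hi : i = m then
      eqToHom (by rw [hi]) ≫ ModuleCat.ofHom h ≫ eqToHom (by
        have : j + 1 = i := hij
        have h2 : m - 1 = j := by lia
        rw [h2])
    else 0
  refine ⟨σ • g - Homotopy.nullHomotopicMap' hom, ?_, ?_⟩
  · intro i hi
    have r1 : (ComplexShape.up ℤ).Rel (i - 1) i := by simp
    have r2 : (ComplexShape.up ℤ).Rel i (i + 1) := by simp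
    rw [sub_f_apply, Homotopy.nullHomotopicMap'_f r1 r2]
    have h0 : hom (i + 1) i r2 = 0 := dif_neg (by lia)
    rw [h0, comp_zero, zero_add]
    by_cases him : i = m
    · subst him
      have h1 : hom i (i - 1) r1 = ModuleCat.ofHom h := by simp [hom]
      rw [h1, hh']
      simp
    · have h1 : hom i (i - 1) r1 = 0 := dif_neg him
      simp [h1, hg i (by lia)]
  · rw [Functor.map_sub, (HomotopyCategory.quotient_map_eq_zero_iff _).2
      ⟨Homotopy.nullHomotopy' hom⟩, sub_zero]

lemma homotopy_induct (σ : R) (P C : CochainComplex (ModuleCat.{v} R) ℤ) (a : ℤ)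
    (hfree : ∀ i, Module.Free R (P.X i)) (hP : ∀ i, i < a → ∀ x : P.X i, x = 0)
    (hσ : ∀ i, a ≤ i → ∀ x : C.homology i, σ • x = 0) (n : ℕ) :
    ∀ (g : P ⟶ C), (∀ i, a + n ≤ i → g.f i = 0) → (kQ R).map (σ ^ n • g) = 0 := by
  induction n with
  | zero =>
    intro g hg
    have : g = 0 := by
      ext i x
      by_cases hi : i < a
      · rw [hP i hi x]; simp
      · rw [hg i (by simpa using hi)]; rfl
    simp [this]
  | succ n ih =>
    intro g hg
    obtain ⟨g', h1, h2⟩ := homotopy_step σ P C (a + n) (hfree _) (hσ _ (by lia)) g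
      (fun i hi => hg i (by push_cast; lia))
    rw [pow_succ, mul_smul, Functor.map_smul, h2, ← Functor.map_smul]
    exact ih g' (fun i hi => h1 i (by lia))

end Helpers

/-- **Lemma 4.6.** There is an integer `l ≥ 0` depending only on `b - a` such that: for every
commutative ring `R`, every `π ∈ R`, and every distinguished triangle
`M₁^• → M₂^• → M₃^• → M₁^•[1]` in the homotopy category `K(R)`, if `M₁^•` is
`π`-`[a+1,b+1]`-pseudo-coherent, `M₂^•` is `π`-`[a,b]`-pseudo-coherent and `M₃^i = 0` for
`i > b`, then `M₃^•` is `π^l`-`[a,b]`-pseudo-coherent. -/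
theorem isPiPseudoCoherent_of_distinguished_triangle :
    ∃ l : ℤ → ℕ, ∀ (a b : ℤ), a ≤ b →
      ∀ (R : Type u) [CommRing R] (π : R) (M₁ M₂ M₃ : CochainComplex (ModuleCat R) ℤ)
        (u : (HomotopyCategory.quotient (ModuleCat R) (ComplexShape.up ℤ)).obj M₁ ⟶
          (HomotopyCategory.quotient (ModuleCat R) (ComplexShape.up ℤ)).obj M₂)
        (v : (HomotopyCategory.quotient (ModuleCat R) (ComplexShape.up ℤ)).obj M₂ ⟶
          (HomotopyCategory.quotient (ModuleCat R) (ComplexShape.up ℤ)).obj M₃)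
        (w : (HomotopyCategory.quotient (ModuleCat R) (ComplexShape.up ℤ)).obj M₃ ⟶
          ((HomotopyCategory.quotient (ModuleCat R) (ComplexShape.up ℤ)).obj M₁)⟦(1 : ℤ)⟧),
        (Triangle.mk u v w ∈
          distTriang (HomotopyCategory (ModuleCat R) (ComplexShape.up ℤ))) →
        IsPiPseudoCoherent π (a + 1) (b + 1) M₁ →
        IsPiPseudoCoherent π a b M₂ →
        (∀ i : ℤ, b < i → ∀ x : M₃.X i, x = 0) →
        IsPiPseudoCoherent (π ^ l (b - a)) a b M₃ := by
  refine ⟨fun d => 3 * (2 * (d + 1).toNat + 1), ?_⟩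
  intro a b hab R _ π M₁ M₂ M₃ u v w hT h₁ h₂ h₃
  refine ⟨h₃, ?_⟩
  obtain ⟨-, P₁, f₁, free₁, fin₁, z₁, iso₁, surj₁⟩ := h₁
  obtain ⟨-, P₂, f₂, free₂, fin₂, z₂, iso₂, surj₂⟩ := h₂
  obtain ⟨u', rfl⟩ := (kQ R).map_surjective u
  set n := (b - a + 1).toNat with hn
  have surj₂' : ∀ i, a ≤ i → IsPiSurjective π ((kH R i).map ((kQ R).map f₂)) := by
    intro i hi
    rw [isPiSurjective_kH_iff]
    rcases hi.eq_or_lt with rfl | hi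
    · exact surj₂
    · exact (iso₂ i hi).2
  have iso₂' : ∀ i, a < i → IsPiIsomorphism π ((kH R i).map ((kQ R).map f₂)) := fun i hi =>
    (isPiIsomorphism_kH_iff _ _ _).2 (iso₂ i hi)
  have hTc := HomotopyCategory.mappingCone_triangleh_distinguished f₂
  have hσ : ∀ i, a + 1 ≤ i → ∀ x : (CochainComplex.mappingCone f₂).homology i,
      π ^ 2 • x = 0 := by
    intro i hi x
    let e := (HomotopyCategory.homologyFunctorFactors (ModuleCat R)
      (ComplexShape.up ℤ) i).app (CochainComplex.mappingCone f₂)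
    exact killed_of_iso (π ^ 2) e (fun y => cone_homology_killed π _ hTc i (i + 1) rfl
      (surj₂' i (by lia)) (iso₂' _ (by lia)) y) x
  have hnull := homotopy_induct (π ^ 2) P₁ (CochainComplex.mappingCone f₂) (a + 1) free₁
    (fun i hi => z₁ i (Or.inl hi)) hσ n
    (f₁ ≫ u' ≫ CochainComplex.mappingCone.inr f₂) (fun i hi => by
      ext x
      rw [z₁ i (Or.inr (by lia)) x]; simp)
  rw [← Linear.smul_comp, ← Category.assoc, Functor.map_comp] at hnull
  set τ : R := (π ^ 2) ^ n with hτ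
  obtain ⟨α, hα⟩ : ∃ α : (kQ R).obj P₁ ⟶ (kQ R).obj P₂,
      (kQ R).map ((τ • f₁) ≫ u') = α ≫ (kQ R).map f₂ :=
    Triangle.coyoneda_exact₂ _ hTc ((kQ R).map ((τ • f₁) ≫ u')) hnull
  obtain ⟨α', rfl⟩ := (kQ R).map_surjective α
  have hT3 := HomotopyCategory.mappingCone_triangleh_distinguished α'
  let φ := completeDistinguishedTriangleMorphism _ _ hT3 hT ((kQ R).map (τ • f₁))
    ((kQ R).map f₂) (by
      rw [Functor.map_comp] at hα
      exact hα.symm)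
  obtain ⟨f₃, hf₃⟩ := (kQ R).map_surjective φ.hom₃
  have surj₁' : ∀ i, a + 1 ≤ i →
      IsPiSurjective (τ * π) ((kH R i).map ((kQ R).map (τ • f₁))) := by
    intro i hi
    rw [isPiSurjective_kH_iff, homologyMap_smul']
    apply IsPiSurjective.smul_map
    rcases hi.eq_or_lt with rfl | hi
    · exact surj₁
    · exact (iso₁ i hi).2
  have iso₁' : ∀ i, a + 1 < i →
      IsPiIsomorphism (τ * π) ((kH R i).map ((kQ R).map (τ • f₁))) := by
    intro i hi
    rw [isPiIsomorphism_kH_iff, homologyMap_smul']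
    exact IsPiIsomorphism.smul_map (iso₁ i hi) τ
  have hρ : π ^ (3 * (2 * n + 1)) = (τ * π) ^ 3 := by
    rw [hτ]; ring
  have surj₃ : ∀ i, a ≤ i → IsPiSurjective (π ^ (3 * (2 * n + 1))) (homologyMap f₃ i) := by
    intro i hi
    rw [← isPiSurjective_kH_iff, hf₃, hρ]
    exact five_surj (τ * π) _ _ hT3 hT φ i (i + 1) rfl
      (IsPiSurjective.mul_left (surj₂' i hi) τ) (surj₁' (i + 1) (by lia))
      (IsPiIsomorphism.mul_left (iso₂' (i + 1) (by lia)) τ)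
  refine ⟨CochainComplex.mappingCone α', f₃, ?_, ?_, ?_, ?_, surj₃ a le_rfl⟩
  · intro i
    have := free₁ (i + 1)
    have := free₂ i
    exact Module.Free.of_equiv (coneEquiv α' i).symm
  · intro i
    have := fin₁ (i + 1)
    have := fin₂ i
    exact Module.Finite.equiv (coneEquiv α' i).symm
  · intro i hi x
    apply (coneEquiv α' i).injective
    rw [map_zero]
    exact Prod.ext (z₁ (i + 1) (by lia) _) (z₂ i hi _)
  · intro i hi
    refine ⟨?_, surj₃ i hi.le⟩
    suffices h : IsPiIsomorphism (π ^ (3 * (2 * n + 1))) ((kH R i).map ((kQ R).map f₃)) from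
      ((isPiIsomorphism_kH_iff _ _ _).1 h).1
    refine ⟨?_, (isPiSurjective_kH_iff _ _ _).2 (surj₃ i hi.le)⟩
    rw [hf₃, hρ]
    exact five_inj (τ * π) _ _ hT3 hT φ i (i + 1) rfl (surj₁' i (by lia))
      (IsPiIsomorphism.mul_left (iso₂' i hi) τ) (iso₁' (i + 1) (by lia))
end

section
/- Let a ≤ b be integers. There exists an integer l ≥ 0 depending only on b−a such that: for every commutative ring R, every π ∈ R, and every short exact sequence of cochain complexes of R-modules 0 → M_1^• → M_2^• → M_3^• → 0 (exact in each degree), if M_1^• is π-[a+1,b+1]-pseudo-coherent and M_2^• is π-[a,b]-pseudo-coherent, then M_3^• is π^l-[a,b]-pseudo-coherent. -/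
open CategoryTheory

universe u

namespace PiAux
variable {R : Type*} [CommRing R]

lemma exists_cycle (K : CochainComplex (ModuleCat R) ℤ) (j k : ℤ) (hk : j + 1 = k)
    (x : K.X j) (hx : K.d j k x = 0) : ∃ c : K.cycles j, K.iCycles j c = x := by
  have hex := ShortComplex.exact_of_f_is_kernel
    (ShortComplex.mk (K.iCycles j) (K.d j k) (K.iCycles_d j k))
    (K.cyclesIsKernel j k (by simp [hk]))
  rw [ShortComplex.moduleCat_exact_iff] at hex
  exact hex x hx

lemma cycle_d (K : CochainComplex (ModuleCat R) ℤ) (j k : ℤ) (c : K.cycles j) :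
    K.d j k (K.iCycles j c) = 0 := by
  rw [← ConcreteCategory.comp_apply, K.iCycles_d j k]; rfl

lemma exists_repr (K : CochainComplex (ModuleCat R) ℤ) (j : ℤ) (y : K.homology j) :
    ∃ c : K.cycles j, K.homologyπ j c = y :=
  (ModuleCat.epi_iff_surjective (K.homologyπ j)).1 inferInstance y

lemma cycles_ext (K : CochainComplex (ModuleCat R) ℤ) (j : ℤ) (c c' : K.cycles j)
    (h : K.iCycles j c = K.iCycles j c') : c = c' :=
  (ModuleCat.mono_iff_injective (K.iCycles j)).1 inferInstance h

lemma homologyπ_eq_zero (K : CochainComplex (ModuleCat R) ℤ) (i j : ℤ) (hi : i + 1 = j)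
    (c : K.cycles j) : K.homologyπ j c = 0 ↔ ∃ z : K.X i, K.iCycles j c = K.d i j z := by
  have hex := ShortComplex.exact_of_g_is_cokernel
    (ShortComplex.mk (K.toCycles i j) (K.homologyπ j) (K.toCycles_comp_homologyπ i j))
    (K.homologyIsCokernel i j (by simp [← hi]))
  rw [ShortComplex.moduleCat_exact_iff] at hex
  have key : ∀ z : K.X i, K.iCycles j (K.toCycles i j z) = K.d i j z := fun z => by
    rw [← ConcreteCategory.comp_apply, K.toCycles_i]
  constructor
  · intro h
    obtain ⟨z, hz⟩ := hex c h
    exact ⟨z, by rw [← key]; exact congrArg _ hz.symm⟩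
  · rintro ⟨z, hz⟩
    rw [← key] at hz
    rw [cycles_ext K j _ _ hz, ← ConcreteCategory.comp_apply, K.toCycles_comp_homologyπ]; rfl

lemma homologyMap_mk {K L : CochainComplex (ModuleCat R) ℤ} (f : K ⟶ L) (j : ℤ) (c : K.cycles j) :
    HomologicalComplex.homologyMap f j (K.homologyπ j c) =
      L.homologyπ j (HomologicalComplex.cyclesMap f j c) := by
  rw [← ConcreteCategory.comp_apply, ← ConcreteCategory.comp_apply,
    HomologicalComplex.homologyπ_naturality]

lemma cyclesMap_i' {K L : CochainComplex (ModuleCat R) ℤ} (f : K ⟶ L) (j : ℤ) (c : K.cycles j) :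
    L.iCycles j (HomologicalComplex.cyclesMap f j c) = f.f j (K.iCycles j c) := by
  rw [← ConcreteCategory.comp_apply, ← ConcreteCategory.comp_apply,
    HomologicalComplex.cyclesMap_i]

lemma surj_iff {K L : CochainComplex (ModuleCat R) ℤ} (f : K ⟶ L) (π : R) (i j k : ℤ)
    (hi : i + 1 = j) (hk : j + 1 = k) :
    (∀ y : L.homology j, ∃ x : K.homology j, π • y = HomologicalComplex.homologyMap f j x) ↔
    ∀ y : L.X j, L.d j k y = 0 → ∃ x : K.X j, K.d j k x = 0 ∧
      ∃ z : L.X i, π • y = f.f j x + L.d i j z := by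
  constructor
  · intro h y hy
    obtain ⟨c, rfl⟩ := exists_cycle L j k hk y hy
    obtain ⟨x, hx⟩ := h (L.homologyπ j c)
    obtain ⟨e, rfl⟩ := exists_repr K j x
    rw [homologyMap_mk, ← map_smul, ← sub_eq_zero, ← map_sub, homologyπ_eq_zero L i j hi] at hx
    obtain ⟨z, hz⟩ := hx
    rw [map_sub, map_smul, cyclesMap_i'] at hz
    exact ⟨_, cycle_d K j k e, z, by rw [← hz]; abel⟩
  · intro h y
    obtain ⟨c, rfl⟩ := exists_repr L j y
    obtain ⟨x, hx, z, hz⟩ := h _ (cycle_d L j k c)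
    obtain ⟨e, rfl⟩ := exists_cycle K j k hk x hx
    refine ⟨K.homologyπ j e, ?_⟩
    rw [homologyMap_mk, ← map_smul, ← sub_eq_zero, ← map_sub, homologyπ_eq_zero L i j hi]
    refine ⟨z, ?_⟩
    rw [map_sub, map_smul, cyclesMap_i', hz]; abel

lemma inj_iff {K L : CochainComplex (ModuleCat R) ℤ} (f : K ⟶ L) (π : R) (i j k : ℤ)
    (hi : i + 1 = j) (hk : j + 1 = k) :
    (∀ x : K.homology j, HomologicalComplex.homologyMap f j x = 0 → π • x = 0) ↔
    ∀ x : K.X j, K.d j k x = 0 → ∀ z : L.X i, f.f j x = L.d i j z →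
      ∃ w : K.X i, π • x = K.d i j w := by
  constructor
  · intro h x hx z hz
    obtain ⟨c, rfl⟩ := exists_cycle K j k hk x hx
    have := h (K.homologyπ j c) (by
      rw [homologyMap_mk, homologyπ_eq_zero L i j hi]
      exact ⟨z, by rw [cyclesMap_i', hz]⟩)
    rw [← map_smul, homologyπ_eq_zero K i j hi] at this
    simpa only [map_smul] using this
  · intro h x hx
    obtain ⟨c, rfl⟩ := exists_repr K j x
    rw [homologyMap_mk, homologyπ_eq_zero L i j hi] at hx
    obtain ⟨z, hz⟩ := hx
    rw [cyclesMap_i'] at hz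
    rw [← map_smul, homologyπ_eq_zero K i j hi]
    simpa only [map_smul] using h _ (cycle_d K j k c) z hz

lemma dd_apply (K : CochainComplex (ModuleCat R) ℤ) (i j k : ℤ) (x : K.X i) :
    K.d j k (K.d i j x) = 0 := by
  rw [← ConcreteCategory.comp_apply, K.d_comp_d]; rfl

lemma comm_apply' {K L : CochainComplex (ModuleCat R) ℤ} (f : K ⟶ L) (i j : ℤ) (x : K.X i) :
    L.d i j (f.f i x) = f.f j (K.d i j x) := by
  rw [← ConcreteCategory.comp_apply, ← ConcreteCategory.comp_apply, f.comm]

lemma free_lift {A B D : Type*} [AddCommGroup A] [AddCommGroup B] [AddCommGroup D]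
    [Module R A] [Module R B] [Module R D] [Module.Free R A] (T : A →ₗ[R] D) (S : B →ₗ[R] D)
    (h : ∀ x, ∃ y, S y = T x) : ∃ l : A →ₗ[R] B, ∀ x, S (l x) = T x := by
  choose y hy using h
  let b := Module.Free.chooseBasis R A
  refine ⟨b.constr R (fun i => y (b i)), fun x => ?_⟩
  have : S ∘ₗ b.constr R (fun i => y (b i)) = T := b.ext fun i => by simp [hy]
  exact LinearMap.congr_fun this x

/-- elementwise surjectivity on homology -/
def ESurj {K L : CochainComplex (ModuleCat R) ℤ} (f : K ⟶ L) (π : R) (j : ℤ) : Prop :=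
  ∀ i k, i + 1 = j → j + 1 = k → ∀ y : L.X j, L.d j k y = 0 → ∃ x : K.X j, K.d j k x = 0 ∧
      ∃ z : L.X i, π • y = f.f j x + L.d i j z

/-- elementwise injectivity on homology -/
def EInj {K L : CochainComplex (ModuleCat R) ℤ} (f : K ⟶ L) (π : R) (j : ℤ) : Prop :=
  ∀ i k, i + 1 = j → j + 1 = k → ∀ x : K.X j, K.d j k x = 0 → ∀ z : L.X i, f.f j x = L.d i j z →
      ∃ w : K.X i, π • x = K.d i j w

/-- Partial lift in degrees at least `m`. -/
def PartialLift {P P' M : CochainComplex (ModuleCat R) ℤ} (θ : P ⟶ M) (f : P' ⟶ M) (m : ℤ) (c : R)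
    (g : ∀ j, P.X j →ₗ[R] P'.X j) (h : ∀ j i, P.X j →ₗ[R] M.X i) : Prop :=
  (∀ j k, m ≤ j → j + 1 = k → ∀ x, P'.d j k (g j x) = g k (P.d j k x)) ∧
  (∀ i j k, m ≤ j → i + 1 = j → j + 1 = k → ∀ x,
    f.f j (g j x) = c • θ.f j x + M.d i j (h j i x) + h k j (P.d j k x))

lemma lift_step {P P' M : CochainComplex (ModuleCat R) ℤ} (θ : P ⟶ M) (f : P' ⟶ M) (π : R)
    (n m : ℤ) (hm : n + 1 = m) (c : R) [Module.Free R (P.X n)]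
    (hs : ESurj f π n) (hi : EInj f π m)
    (g : ∀ j, P.X j →ₗ[R] P'.X j) (h : ∀ j i, P.X j →ₗ[R] M.X i) (H : PartialLift θ f m c g h) :
    ∃ g' h', PartialLift θ f n (π ^ 2 * c) g' h' := by
  obtain ⟨Hg, Hh⟩ := H
  let S : (P'.X n × M.X (n - 1)) →ₗ[R] (P'.X m × M.X n) :=
    LinearMap.prod ((P'.d n m).hom ∘ₗ LinearMap.fst R _ _)
      ((f.f n).hom ∘ₗ LinearMap.fst R _ _ - (M.d (n - 1) n).hom ∘ₗ LinearMap.snd R _ _)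
  let T : P.X n →ₗ[R] (P'.X m × M.X n) :=
    LinearMap.prod (π ^ 2 • (g m ∘ₗ (P.d n m).hom))
      (π ^ 2 • (c • (θ.f n).hom + h m n ∘ₗ (P.d n m).hom))
  obtain ⟨l, hl⟩ := free_lift T S (by
    intro x
    obtain ⟨w, hw⟩ := hi n (m + 1) hm rfl (g m (P.d n m x))
      (by rw [Hg m (m + 1) le_rfl rfl, dd_apply, map_zero])
      (c • θ.f n x + h m n (P.d n m x)) (by
        rw [Hh n m (m + 1) le_rfl hm rfl, dd_apply, map_zero, map_add, map_smul, comm_apply']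
        abel)
    obtain ⟨y, hy, z, hz⟩ := hs (n - 1) m (by ring) hm
      (f.f n w - π • (c • θ.f n x + h m n (P.d n m x))) (by
        rw [map_sub, comm_apply', ← hw, map_smul, map_smul,
          Hh n m (m + 1) le_rfl hm rfl, dd_apply, map_zero, map_add, map_smul, comm_apply']
        simp)
    refine ⟨(π • w - y, z), Prod.ext ?_ ?_⟩
    · change P'.d n m (π • w - y) = π ^ 2 • g m (P.d n m x)
      rw [map_sub, hy, map_smul, ← hw, smul_smul, sub_zero, pow_two]
    · change f.f n (π • w - y) - M.d (n - 1) n z = π ^ 2 • (c • θ.f n x + h m n (P.d n m x))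
      rw [map_sub, sub_sub, ← hz, map_smul]
      module)
  have hl1 : ∀ x, P'.d n m (l x).1 = π ^ 2 • g m (P.d n m x) := fun x => congrArg Prod.fst (hl x)
  have hl2 : ∀ x, f.f n (l x).1 - M.d (n - 1) n (l x).2 =
      π ^ 2 • (c • θ.f n x + h m n (P.d n m x)) := fun x => congrArg Prod.snd (hl x)
  refine ⟨Function.update (fun j => π ^ 2 • g j) n (LinearMap.fst R _ _ ∘ₗ l),
    Function.update (fun j i => π ^ 2 • h j i) n
      (Function.update (fun i => 0) (n - 1) (LinearMap.snd R _ _ ∘ₗ l)), ?_, ?_⟩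
  · intro j k hj hk x
    rw [Function.update_of_ne (by omega : k ≠ n)]
    by_cases hjn : j = n
    · subst hjn
      obtain rfl : k = m := by omega
      rw [Function.update_self]
      exact hl1 x
    · rw [Function.update_of_ne hjn]
      change P'.d j k (π ^ 2 • g j x) = π ^ 2 • g k (P.d j k x)
      rw [map_smul, Hg j k (by omega) hk]
  · intro i j k hj hij hk x
    rw [Function.update_of_ne (by omega : k ≠ n)]
    by_cases hjn : j = n
    · subst hjn
      obtain rfl : k = m := by omega
      obtain rfl : i = j - 1 := by omega
      rw [Function.update_self, Function.update_self, Function.update_self]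
      change f.f j (l x).1 = _ + M.d (j - 1) j (l x).2 + π ^ 2 • h k j (P.d j k x)
      rw [sub_eq_iff_eq_add.1 (hl2 x)]
      module
    · rw [Function.update_of_ne hjn, Function.update_of_ne hjn]
      change f.f j (π ^ 2 • g j x) = _ + M.d i j (π ^ 2 • h j i x) + π ^ 2 • h k j (P.d j k x)
      rw [map_smul, map_smul, Hh i j k (by omega) hij hk]
      module

lemma exists_lift {P P' M : CochainComplex (ModuleCat R) ℤ} (θ : P ⟶ M) (f : P' ⟶ M) (π : R)
    (a b : ℤ) (hfree : ∀ i, Module.Free R (P.X i))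
    (hz : ∀ i, i < a + 1 ∨ b + 1 < i → ∀ x : P.X i, x = 0)
    (hs : ∀ j, a ≤ j → ESurj f π j) (hi : ∀ j, a < j → EInj f π j) (n : ℕ) :
    (n : ℤ) ≤ b + 1 - a → ∃ g h, PartialLift θ f (b + 2 - n) (π ^ (2 * n)) g h := by
  induction n with
  | zero =>
    intro _
    refine ⟨fun _ => 0, fun _ _ => 0, ?_, ?_⟩
    · intro j k hj hk x
      simp
    · intro i j k hj _ hk x
      rw [hz j (by right; push_cast at hj; omega) x]
      simp
  | succ n ih =>
    intro hn
    push_cast at hn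
    obtain ⟨g, h, H⟩ := ih (by omega)
    have := lift_step θ f π (b + 2 - (n + 1 : ℕ)) (b + 2 - n) (by push_cast; ring) _
      (hs _ (by push_cast; omega)) (hi _ (by omega)) g h H
    rwa [← pow_add, show 2 + 2 * n = 2 * (n + 1) by ring] at this

lemma exists_full_lift {P P' M : CochainComplex (ModuleCat R) ℤ} (θ : P ⟶ M) (f : P' ⟶ M) (π : R)
    (a b : ℤ) (hab : a ≤ b) (hfree : ∀ i, Module.Free R (P.X i))
    (hz : ∀ i, i < a + 1 ∨ b + 1 < i → ∀ x : P.X i, x = 0)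
    (hs : ∀ j, a ≤ j → ESurj f π j) (hi : ∀ j, a < j → EInj f π j) :
    ∃ (g : ∀ j, P.X j →ₗ[R] P'.X j) (h : ∀ j i, P.X j →ₗ[R] M.X i),
      (∀ j k, j + 1 = k → ∀ x, P'.d j k (g j x) = g k (P.d j k x)) ∧
      (∀ i j k, i + 1 = j → j + 1 = k → ∀ x,
        f.f j (g j x) = π ^ (2 * (b - a + 1).toNat) • θ.f j x + M.d i j (h j i x)
          + h k j (P.d j k x)) := by
  obtain ⟨g, h, H1, H2⟩ := exists_lift θ f π a b hfree hz hs hi (b - a + 1).toNat (by omega)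
  refine ⟨g, h, fun j k hk x => ?_, fun i j k hij hk x => ?_⟩
  · by_cases hj : j < a + 1
    · rw [hz j (Or.inl hj) x]; simp
    · exact H1 j k (by omega) hk x
  · by_cases hj : j < a + 1
    · rw [hz j (Or.inl hj) x]; simp
    · exact H2 i j k (by omega) hij hk x

section cone
variable {P P' M N : CochainComplex (ModuleCat R) ℤ}

/-- The differential of the cone. -/
noncomputable def coneD (g : ∀ j, P.X j →ₗ[R] P'.X j) (i : ℤ) :
    ModuleCat.of R (P.X (i + 1) × P'.X i) ⟶ ModuleCat.of R (P.X (i + 1 + 1) × P'.X (i + 1)) :=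
  ModuleCat.ofHom (LinearMap.prod
      (-((P.d (i + 1) (i + 1 + 1)).hom ∘ₗ LinearMap.fst R _ _))
      (g (i + 1) ∘ₗ LinearMap.fst R _ _ + (P'.d i (i + 1)).hom ∘ₗ LinearMap.snd R _ _))

/-- The cone of a degreewise chain map. -/
noncomputable def coneC (g : ∀ j, P.X j →ₗ[R] P'.X j)
    (hg : ∀ j k, j + 1 = k → ∀ x, P'.d j k (g j x) = g k (P.d j k x)) :
    CochainComplex (ModuleCat R) ℤ :=
  CochainComplex.of (fun i => ModuleCat.of R (P.X (i + 1) × P'.X i))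
    (coneD g)
    (fun i => by
      ext1
      refine LinearMap.ext fun x => Prod.ext ?_ ?_
      · change -(P.d (i + 1 + 1) (i + 1 + 1 + 1) (-(P.d (i + 1) (i + 1 + 1) x.1))) = 0
        rw [map_neg, dd_apply]; simp
      · change g (i + 1 + 1) (-(P.d (i + 1) (i + 1 + 1) x.1)) + P'.d (i + 1) (i + 1 + 1)
          (g (i + 1) x.1 + P'.d i (i + 1) x.2) = 0
        rw [map_add, hg _ _ rfl, dd_apply, map_neg]; simp)

lemma coneC_d (g : ∀ j, P.X j →ₗ[R] P'.X j)
    (hg : ∀ j k, j + 1 = k → ∀ x, P'.d j k (g j x) = g k (P.d j k x)) (i : ℤ)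
    (x : P.X (i + 1)) (y : P'.X i) :
    (coneC g hg).d i (i + 1) ((x, y) : P.X (i + 1) × P'.X i) =
      ((-(P.d (i + 1) (i + 1 + 1) x), g (i + 1) x + P'.d i (i + 1) y) :
        P.X (i + 1 + 1) × P'.X (i + 1)) := by
  have : (coneC g hg).d i (i + 1) = coneD g i :=
    CochainComplex.of_d (fun i => ModuleCat.of R (P.X (i + 1) × P'.X i)) (coneD g) i
  exact congrArg (fun q : (coneC g hg).X i ⟶ (coneC g hg).X (i + 1) => q.hom (x, y)) this

/-- The map from the cone. -/
noncomputable def coneMap (g : ∀ j, P.X j →ₗ[R] P'.X j)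
    (hg : ∀ j k, j + 1 = k → ∀ x, P'.d j k (g j x) = g k (P.d j k x))
    (f : P' ⟶ M) (θ : P ⟶ M) (β : M ⟶ N) (c : R) (h : ∀ j i, P.X j →ₗ[R] M.X i)
    (hh : ∀ i j k, i + 1 = j → j + 1 = k → ∀ x,
        f.f j (g j x) = c • θ.f j x + M.d i j (h j i x) + h k j (P.d j k x))
    (hβ : ∀ i x, β.f i (θ.f i x) = 0) : coneC g hg ⟶ N where
  f i := ModuleCat.ofHom ((β.f i).hom ∘ₗ (h (i + 1) i ∘ₗ LinearMap.fst R _ _ +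
    (f.f i).hom ∘ₗ LinearMap.snd R _ _))
  comm' i j hij := by
    obtain rfl : i + 1 = j := hij
    ext1
    refine LinearMap.ext fun ⟨x, y⟩ => ?_
    change N.d i (i + 1) (β.f i (h (i + 1) i x + f.f i y)) = _
    refine Eq.trans ?_ (congrArg (fun q : P.X (i + 1 + 1) × P'.X (i + 1) =>
      β.f (i + 1) (h (i + 1 + 1) (i + 1) q.1 + f.f (i + 1) q.2)) (coneC_d g hg i x y)).symm
    change _ = β.f (i + 1) (h (i + 1 + 1) (i + 1) (-(P.d (i + 1) (i + 1 + 1) x)) +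
      f.f (i + 1) (g (i + 1) x + P'.d i (i + 1) y))
    rw [comm_apply', map_add, map_add (f.f (i + 1)).hom, hh i (i + 1) (i + 1 + 1) rfl rfl,
      ← comm_apply', map_neg]
    simp only [map_add, map_neg, map_smul, hβ, smul_zero, zero_add]
    abel

lemma coneMap_f (g : ∀ j, P.X j →ₗ[R] P'.X j)
    (hg : ∀ j k, j + 1 = k → ∀ x, P'.d j k (g j x) = g k (P.d j k x))
    (f : P' ⟶ M) (θ : P ⟶ M) (β : M ⟶ N) (c : R) (h : ∀ j i, P.X j →ₗ[R] M.X i)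
    (hh : ∀ i j k, i + 1 = j → j + 1 = k → ∀ x,
        f.f j (g j x) = c • θ.f j x + M.d i j (h j i x) + h k j (P.d j k x))
    (hβ : ∀ i x, β.f i (θ.f i x) = 0) (i : ℤ) (x : P.X (i + 1)) (y : P'.X i) :
    (coneMap g hg f θ β c h hh hβ).f i ((x, y) : P.X (i + 1) × P'.X i) =
      β.f i (h (i + 1) i x + f.f i y) := rfl

end cone

section final
variable {P P' L M N : CochainComplex (ModuleCat R) ℤ}

lemma cone_surj (g : ∀ j, P.X j →ₗ[R] P'.X j)
    (hg : ∀ j k, j + 1 = k → ∀ x, P'.d j k (g j x) = g k (P.d j k x))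
    (f₁ : P ⟶ L) (f : P' ⟶ M) (α : L ⟶ M) (β : M ⟶ N) (c π : R) (h : ∀ j i, P.X j →ₗ[R] M.X i)
    (hh : ∀ i j k, i + 1 = j → j + 1 = k → ∀ x,
        f.f j (g j x) = c • (f₁ ≫ α).f j x + M.d i j (h j i x) + h k j (P.d j k x))
    (hβ : ∀ i x, β.f i ((f₁ ≫ α).f i x) = 0)
    (hinj : ∀ i : ℤ, Function.Injective (α.f i))
    (hex : ∀ i : ℤ, Function.Exact (α.f i) (β.f i))
    (hsurj : ∀ i : ℤ, Function.Surjective (β.f i)) (j : ℤ)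
    (s₁ : ESurj f₁ π (j + 1)) (s₂ : ESurj f π j) (i₂ : EInj f π (j + 1)) :
    ESurj (coneMap g hg f (f₁ ≫ α) β c h hh hβ) (c * π ^ 3) j := by
  intro i k hi hk y hy
  subst hk
  obtain ⟨m, rfl⟩ := hsurj j y
  rw [comm_apply'] at hy
  obtain ⟨n, hn⟩ := (hex _ _).1 hy
  have hdn : L.d (j + 1) (j + 1 + 1) n = 0 := by
    apply hinj
    rw [← comm_apply', hn, dd_apply, map_zero]
  obtain ⟨x, hx, z, hz⟩ := s₁ j _ rfl rfl n hdn
  have hgx : P'.d (j + 1) (j + 1 + 1) (g (j + 1) x) = 0 := by rw [hg _ _ rfl, hx, map_zero]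
  have hα : α.f (j + 1) (f₁.f (j + 1) x) = M.d j (j + 1) (π • m - α.f j z) := by
    rw [map_sub, comm_apply', map_smul, ← hn, ← map_smul, hz, map_add]; abel
  have hfg : f.f (j + 1) (g (j + 1) x) =
      M.d j (j + 1) (c • (π • m - α.f j z) + h (j + 1) j x) := by
    rw [hh j (j + 1) _ rfl rfl, hx, map_zero, add_zero, map_add, map_smul, ← hα]; rfl
  obtain ⟨w, hw⟩ := i₂ j _ rfl rfl _ hgx _ hfg
  obtain ⟨y₂, hy₂, z₂, hz₂⟩ := s₂ i _ hi rfl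
    (π • (c • (π • m - α.f j z) + h (j + 1) j x) - f.f j w) (by
      rw [map_sub, map_smul, ← hfg, comm_apply', ← hw, map_smul, sub_self])
  refine ⟨((-(π ^ 2 • x), y₂ + π • w) : P.X (j + 1) × P'.X j), ?_, β.f i z₂, ?_⟩
  · refine (coneC_d g hg j _ _).trans (Prod.ext ?_ ?_)
    · change -(P.d (j + 1) (j + 1 + 1) (-(π ^ 2 • x))) = 0
      rw [map_neg, map_smul, hx]; simp
    · change g (j + 1) (-(π ^ 2 • x)) + P'.d j (j + 1) (y₂ + π • w) = 0
      rw [map_add, hy₂, map_smul, ← hw, map_neg, map_smul]; module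
  · have hαz : β.f j (α.f j z) = 0 := (hex j _).2 ⟨z, rfl⟩
    have key := congrArg (β.f j) hz₂
    refine Eq.trans ?_ (congrArg (· + N.d i j (β.f i z₂)) (coneMap_f g hg f (f₁ ≫ α) β c h hh hβ j
      (-(π ^ 2 • x)) (y₂ + π • w)).symm)
    rw [comm_apply']
    simp only [map_add, map_sub, map_neg, map_smul, hαz] at key ⊢
    rw [add_assoc, add_assoc, add_comm (π • _), ← add_assoc (β.f j (f.f j y₂)), ← key]
    module

lemma cone_inj (g : ∀ j, P.X j →ₗ[R] P'.X j)
    (hg : ∀ j k, j + 1 = k → ∀ x, P'.d j k (g j x) = g k (P.d j k x))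
    (f₁ : P ⟶ L) (f : P' ⟶ M) (α : L ⟶ M) (β : M ⟶ N) (c π : R) (h : ∀ j i, P.X j →ₗ[R] M.X i)
    (hh : ∀ i j k, i + 1 = j → j + 1 = k → ∀ x,
        f.f j (g j x) = c • (f₁ ≫ α).f j x + M.d i j (h j i x) + h k j (P.d j k x))
    (hβ : ∀ i x, β.f i ((f₁ ≫ α).f i x) = 0)
    (hinj : ∀ i : ℤ, Function.Injective (α.f i))
    (hex : ∀ i : ℤ, Function.Exact (α.f i) (β.f i))
    (hsurj : ∀ i : ℤ, Function.Surjective (β.f i)) (j : ℤ)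
    (s₁ : ESurj f₁ π j) (i₁ : EInj f₁ π (j + 1)) (i₂ : EInj f π j) :
    EInj (coneMap g hg f (f₁ ≫ α) β c h hh hβ) (c * π ^ 3) j := by
  intro i k hi hk q hq t ht
  subst hk
  subst hi
  obtain ⟨x, y⟩ : P.X (i + 1 + 1) × P'.X (i + 1) := q
  have hq' := (coneC_d g hg _ x y).symm.trans hq
  have hx : P.d (i + 1 + 1) (i + 1 + 1 + 1) x = 0 := neg_eq_zero.1 (congrArg Prod.fst hq')
  have hy : g (i + 1 + 1) x + P'.d (i + 1) (i + 1 + 1) y = 0 := congrArg Prod.snd hq'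
  have ht' := (coneMap_f g hg f (f₁ ≫ α) β c h hh hβ _ x y).symm.trans ht
  obtain ⟨s, rfl⟩ := hsurj i t
  rw [comm_apply', ← sub_eq_zero, ← map_sub] at ht'
  obtain ⟨n, hn⟩ := (hex _ _).1 ht'
  have hθ : ∀ j (u : P.X j), (f₁ ≫ α).f j u = α.f j (f₁.f j u) := fun _ _ => rfl
  have hdy : P'.d (i + 1) (i + 1 + 1) y = -g (i + 1 + 1) x := eq_neg_of_add_eq_zero_right hy
  have hdn : L.d (i + 1) (i + 1 + 1) n = -(c • f₁.f (i + 1 + 1) x) := by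
    apply hinj
    rw [← comm_apply', hn, map_sub, dd_apply, map_add, comm_apply', hdy, map_neg,
      hh (i + 1) _ _ rfl rfl, hx, map_zero, map_neg, map_smul, hθ]
    abel
  obtain ⟨w, hw⟩ := i₁ (i + 1) _ rfl rfl (c • x) (by rw [map_smul, hx, smul_zero]) (-n)
    (by rw [map_neg, hdn, neg_neg, map_smul])
  obtain ⟨x', hx', z, hz⟩ := s₁ i _ rfl rfl (f₁.f (i + 1) w + π • n) (by
    rw [map_add, comm_apply', ← hw, map_smul, map_smul, map_smul, hdn]; module)
  obtain ⟨w', hw'⟩ : ∃ w', w' = π • w - x' := ⟨_, rfl⟩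
  have hdw' : P.d (i + 1) (i + 1 + 1) w' = (π ^ 2 * c) • x := by
    rw [hw', map_sub, hx', map_smul, ← hw]; module
  have hfw' : f₁.f (i + 1) w' = L.d i (i + 1) z - π ^ 2 • n := by
    rw [hw', map_sub, map_smul, ← sub_eq_zero]
    rw [smul_add, ← sub_eq_zero] at hz
    rw [← hz]; module
  obtain ⟨v, hv⟩ := i₂ i _ rfl rfl ((π ^ 2 * c) • y + g (i + 1) w')
    (by rw [map_add, map_smul, hdy, hg _ _ rfl, hdw', map_smul]; module)
    ((π ^ 2 * c) • s + c • α.f i z + h (i + 1) i w') (by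
      rw [map_add, map_smul, hh i _ _ rfl rfl, hθ, hfw', hdw', map_sub, map_smul, map_smul, hn]
      simp only [map_add, map_smul, comm_apply']
      module)
  refine ⟨((-(π • w'), v) : P.X (i + 1) × P'.X i), Eq.trans ?_ (coneC_d g hg i _ _).symm⟩
  refine Prod.ext ?_ ?_
  · change (c * π ^ 3) • x = -(P.d (i + 1) (i + 1 + 1) (-(π • w')))
    rw [map_neg, map_smul, hdw']; module
  · change (c * π ^ 3) • y = g (i + 1) (-(π • w')) + P'.d i (i + 1) v
    rw [← hv, map_neg, map_smul]; module

end final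

end PiAux

open PiAux

/-- **Proposition 4.7(1).** There is an integer `l ≥ 0` depending only on `b - a` such that:
for every commutative ring `R`, every `π ∈ R`, and every short exact sequence of cochain
complexes of `R`-modules `0 → M₁^• → M₂^• → M₃^• → 0` (exact in each degree), if `M₁^•` is
`π`-`[a+1,b+1]`-pseudo-coherent and `M₂^•` is `π`-`[a,b]`-pseudo-coherent, then `M₃^•` is
`π^l`-`[a,b]`-pseudo-coherent. -/
theorem isPiPseudoCoherent_of_shortExact_third :
    ∃ l : ℤ → ℕ, ∀ (a b : ℤ), a ≤ b →
      ∀ (R : Type u) [CommRing R] (π : R) (M₁ M₂ M₃ : CochainComplex (ModuleCat R) ℤ)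
        (α : M₁ ⟶ M₂) (β : M₂ ⟶ M₃),
        (∀ i : ℤ, Function.Injective (α.f i)) →
        (∀ i : ℤ, Function.Exact (α.f i) (β.f i)) →
        (∀ i : ℤ, Function.Surjective (β.f i)) →
        IsPiPseudoCoherent π (a + 1) (b + 1) M₁ →
        IsPiPseudoCoherent π a b M₂ →
        IsPiPseudoCoherent (π ^ l (b - a)) a b M₃ := by
  refine ⟨fun n => 2 * (n + 1).toNat + 3, ?_⟩
  intro a b hab R _ π M₁ M₂ M₃ α β hinj hex hsurj h₁ h₂
  obtain ⟨_, P₁, f₁, free₁, fin₁, z₁, iso₁, sur₁⟩ := h₁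
  obtain ⟨zM₂, P₂, f₂, free₂, fin₂, z₂, iso₂, sur₂⟩ := h₂
  refine ⟨fun i hi x => ?_, ?_⟩
  · obtain ⟨y, rfl⟩ := hsurj i x
    rw [zM₂ i hi y, map_zero]
  have S₁ : ∀ j, a + 1 ≤ j → ESurj f₁ π j := by
    intro j hj i k hi hk
    rcases hj.eq_or_lt with rfl | hj
    · exact (surj_iff f₁ π i _ k hi hk).1 sur₁
    · exact (surj_iff f₁ π i _ k hi hk).1 (iso₁ j hj).2
  have S₂ : ∀ j, a ≤ j → ESurj f₂ π j := by
    intro j hj i k hi hk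
    rcases hj.eq_or_lt with rfl | hj
    · exact (surj_iff f₂ π i _ k hi hk).1 sur₂
    · exact (surj_iff f₂ π i _ k hi hk).1 (iso₂ j hj).2
  have I₁ : ∀ j, a + 1 < j → EInj f₁ π j := fun j hj i k hi hk =>
    (inj_iff f₁ π i _ k hi hk).1 (iso₁ j hj).1
  have I₂ : ∀ j, a < j → EInj f₂ π j := fun j hj i k hi hk =>
    (inj_iff f₂ π i _ k hi hk).1 (iso₂ j hj).1
  obtain ⟨g, h, hg, hh⟩ := exists_full_lift (f₁ ≫ α) f₂ π a b hab free₁ z₁ S₂ I₂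
  have hβ : ∀ i x, β.f i ((f₁ ≫ α).f i x) = 0 := fun i x => (hex i _).2 ⟨f₁.f i x, rfl⟩
  have S₃ : ∀ j, a ≤ j → ESurj (coneMap g hg f₂ (f₁ ≫ α) β _ h hh hβ)
      (π ^ (2 * (b - a + 1).toNat + 3)) j := fun j hj => by
    rw [pow_add]
    exact cone_surj g hg f₁ f₂ α β _ π h hh hβ hinj hex hsurj j (S₁ _ (by omega)) (S₂ _ hj)
      (I₂ _ (by omega))
  have I₃ : ∀ j, a < j → EInj (coneMap g hg f₂ (f₁ ≫ α) β _ h hh hβ)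
      (π ^ (2 * (b - a + 1).toNat + 3)) j := fun j hj => by
    rw [pow_add]
    exact cone_inj g hg f₁ f₂ α β _ π h hh hβ hinj hex hsurj j (S₁ _ (by omega))
      (I₁ _ (by omega)) (I₂ _ hj)
  refine ⟨coneC g hg, coneMap g hg f₂ (f₁ ≫ α) β _ h hh hβ, ?_, ?_, ?_, ?_, ?_⟩
  · intro i
    exact inferInstanceAs (Module.Free R (P₁.X (i + 1) × P₂.X i))
  · intro i
    exact inferInstanceAs (Module.Finite R (P₁.X (i + 1) × P₂.X i))
  · intro i hi x
    exact Prod.ext (z₁ (i + 1) (by omega) _) (z₂ i hi _)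
  · intro j hj
    exact ⟨(inj_iff _ _ (j - 1) j (j + 1) (by ring) rfl).2 (I₃ j hj _ _ (by ring) rfl),
      (surj_iff _ _ (j - 1) j (j + 1) (by ring) rfl).2 (S₃ j hj.le _ _ (by ring) rfl)⟩
  · exact (surj_iff _ _ (a - 1) a (a + 1) (by ring) rfl).2 (S₃ a le_rfl _ _ (by ring) rfl)
end

section
/- Let a ≤ b be integers. There exists an integer l ≥ 0 depending only on b−a such that: for every commutative ring R, every π ∈ R, and every short exact sequence of cochain complexes of R-modules 0 → M_1^• → M_2^• → M_3^• → 0 (exact in each degree), if M_1^• and M_3^• are both π-[a,b]-pseudo-coherent, then M_2^• is π^l-[a,b]-pseudo-coherent. -/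
open CategoryTheory

theorem pc_exists_lift {R P X Y : Type*} [CommRing R] [AddCommGroup P] [Module R P]
    [AddCommGroup X] [Module R X] [AddCommGroup Y] [Module R Y] [Module.Projective R P]
    (L₁ : P →ₗ[R] Y) (L₂ : X →ₗ[R] Y) (h : ∀ q, ∃ x, L₂ x = L₁ q) :
    ∃ φ : P →ₗ[R] X, ∀ q, L₂ (φ q) = L₁ q := by
  obtain ⟨φ, hφ⟩ := Module.projective_lifting_property L₂.rangeRestrict
    (L₁.codRestrict (LinearMap.range L₂) (fun q => h q)) L₂.surjective_rangeRestrict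
  refine ⟨φ, fun q => ?_⟩
  have := congrArg Subtype.val (LinearMap.congr_fun hφ q)
  exact this

section Core

variable {R : Type*} [CommRing R]

/-- injectivity up to `r` of the map induced on `H^{i+1}` -/
def PcInj (r : R) {P M : ℤ → Type*} [∀ i, AddCommGroup (P i)] [∀ i, Module R (P i)]
    [∀ i, AddCommGroup (M i)] [∀ i, Module R (M i)]
    (dP : ∀ i, P i →ₗ[R] P (i + 1)) (dM : ∀ i, M i →ₗ[R] M (i + 1))
    (f : ∀ i, P i →ₗ[R] M i) (i : ℤ) : Prop :=
  ∀ z : P (i + 1), dP (i + 1) z = 0 → ∀ n : M i, f (i + 1) z = dM i n →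
    ∃ w : P i, r • z = dP i w

/-- surjectivity up to `r` of the map induced on `H^{i+1}` -/
def PcSurj (r : R) {P M : ℤ → Type*} [∀ i, AddCommGroup (P i)] [∀ i, Module R (P i)]
    [∀ i, AddCommGroup (M i)] [∀ i, Module R (M i)]
    (dP : ∀ i, P i →ₗ[R] P (i + 1)) (dM : ∀ i, M i →ₗ[R] M (i + 1))
    (f : ∀ i, P i →ₗ[R] M i) (i : ℤ) : Prop :=
  ∀ m : M (i + 1), dM (i + 1) m = 0 →
    ∃ z : P (i + 1), dP (i + 1) z = 0 ∧ ∃ n : M i, r • m = f (i + 1) z + dM i n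

variable {P₁ P₃ M₁ M₂ M₃ : ℤ → Type*}
  [∀ i, AddCommGroup (P₁ i)] [∀ i, Module R (P₁ i)]
  [∀ i, AddCommGroup (P₃ i)] [∀ i, Module R (P₃ i)]
  [∀ i, AddCommGroup (M₁ i)] [∀ i, Module R (M₁ i)]
  [∀ i, AddCommGroup (M₂ i)] [∀ i, Module R (M₂ i)]
  [∀ i, AddCommGroup (M₃ i)] [∀ i, Module R (M₃ i)]
  {dP₁ : ∀ i, P₁ i →ₗ[R] P₁ (i + 1)} {dP₃ : ∀ i, P₃ i →ₗ[R] P₃ (i + 1)}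
  {dM₁ : ∀ i, M₁ i →ₗ[R] M₁ (i + 1)} {dM₂ : ∀ i, M₂ i →ₗ[R] M₂ (i + 1)}
  {dM₃ : ∀ i, M₃ i →ₗ[R] M₃ (i + 1)}
  {f₁ : ∀ i, P₁ i →ₗ[R] M₁ i} {f₃ : ∀ i, P₃ i →ₗ[R] M₃ i}
  {α : ∀ i, M₁ i →ₗ[R] M₂ i} {β : ∀ i, M₂ i →ₗ[R] M₃ i}

theorem pc_step (π c : R) (i : ℤ)
    (ddP₃ : ∀ i x, dP₃ (i + 1) (dP₃ i x) = 0)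
    (ddM₁ : ∀ i x, dM₁ (i + 1) (dM₁ i x) = 0)
    (ddM₂ : ∀ i x, dM₂ (i + 1) (dM₂ i x) = 0)
    (cf₁ : ∀ i x, f₁ (i + 1) (dP₁ i x) = dM₁ i (f₁ i x))
    (cf₃ : ∀ i x, f₃ (i + 1) (dP₃ i x) = dM₃ i (f₃ i x))
    (cα : ∀ i x, α (i + 1) (dM₁ i x) = dM₂ i (α i x))
    (cβ : ∀ i x, β (i + 1) (dM₂ i x) = dM₃ i (β i x))
    (hα : ∀ i, Function.Injective (α i)) (hαβ : ∀ i, Function.Exact (α i) (β i))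
    (hβ : ∀ i, Function.Surjective (β i))
    (inj : PcInj π dP₁ dM₁ f₁ (i + 1)) (surj : PcSurj π dP₁ dM₁ f₁ i)
    (g : ∀ i, P₃ i →ₗ[R] M₂ i) (θ : ∀ i, P₃ i →ₗ[R] P₁ (i + 1))
    (h1 : ∀ q, β (i + 1) (g (i + 1) q) = c • f₃ (i + 1) q)
    (h2 : ∀ q, dM₂ (i + 1) (g (i + 1) q) =
      α (i + 1 + 1) (f₁ (i + 1 + 1) (θ (i + 1) q)) + g (i + 1 + 1) (dP₃ (i + 1) q))
    (h3 : ∀ q, dP₁ (i + 1 + 1) (θ (i + 1) q) = - θ (i + 1 + 1) (dP₃ (i + 1) q))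
    (q : P₃ i) :
    ∃ (t : P₁ (i + 1)) (y : M₂ i), β i y = (π ^ 2 * c) • f₃ i q ∧
      dM₂ i y = α (i + 1) (f₁ (i + 1) t) + π ^ 2 • g (i + 1) (dP₃ i q) ∧
      dP₁ (i + 1) t = - (π ^ 2 • θ (i + 1) (dP₃ i q)) := by
  obtain ⟨m, hm⟩ := hβ i (c • f₃ i q)
  obtain ⟨n, hn⟩ := (hαβ (i + 1) (dM₂ i m - g (i + 1) (dP₃ i q))).1 (by
    rw [map_sub, cβ, hm, h1, cf₃, map_smul, sub_self])
  have hz : dP₁ (i + 1 + 1) (θ (i + 1) (dP₃ i q)) = 0 := by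
    rw [h3, ddP₃, map_zero, neg_zero]
  have hdn : dM₁ (i + 1) n = - f₁ (i + 1 + 1) (θ (i + 1) (dP₃ i q)) := by
    apply hα
    rw [cα, hn, map_sub, ddM₂, h2, ddP₃, map_zero, map_neg]
    abel
  obtain ⟨w, hw⟩ := inj _ hz (-n) (by rw [map_neg, hdn, neg_neg])
  obtain ⟨p, hp, n', hn'⟩ := surj (π • n + f₁ (i + 1) w) (by
    rw [map_add, map_smul, ← cf₁, ← hw, hdn, map_smul, smul_neg, neg_add_cancel])
  refine ⟨p - π • w, π ^ 2 • m - α i n', ?_, ?_, ?_⟩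
  · rw [map_sub, (hαβ i).apply_apply_eq_zero, map_smul, hm, mul_smul, sub_zero]
  · have e : dM₂ i m = α (i + 1) n + g (i + 1) (dP₃ i q) := by rw [hn]; abel
    have e' := congrArg (α (i + 1)) hn'
    simp only [map_add, map_smul, smul_add, smul_smul] at e'
    rw [map_sub, map_smul, e, ← cα, map_sub, map_sub, map_smul, map_smul, smul_add, pow_two]
    linear_combination (norm := module) e'
  · rw [map_sub, hp, map_smul, ← hw, smul_smul, pow_two, zero_sub]

theorem pc_build (π : R) (a b : ℤ) (hproj : ∀ i, Module.Projective R (P₃ i))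
    (hb : ∀ i, b < i → ∀ x : P₃ i, x = 0)
    (ddP₃ : ∀ i x, dP₃ (i + 1) (dP₃ i x) = 0)
    (ddM₁ : ∀ i x, dM₁ (i + 1) (dM₁ i x) = 0)
    (ddM₂ : ∀ i x, dM₂ (i + 1) (dM₂ i x) = 0)
    (cf₁ : ∀ i x, f₁ (i + 1) (dP₁ i x) = dM₁ i (f₁ i x))
    (cf₃ : ∀ i x, f₃ (i + 1) (dP₃ i x) = dM₃ i (f₃ i x))
    (cα : ∀ i x, α (i + 1) (dM₁ i x) = dM₂ i (α i x))
    (cβ : ∀ i x, β (i + 1) (dM₂ i x) = dM₃ i (β i x))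
    (hα : ∀ i, Function.Injective (α i)) (hαβ : ∀ i, Function.Exact (α i) (β i))
    (hβ : ∀ i, Function.Surjective (β i))
    (inj : ∀ i, a ≤ i → PcInj π dP₁ dM₁ f₁ i) (surj : ∀ i, a ≤ i + 1 → PcSurj π dP₁ dM₁ f₁ i)
    (n : ℕ) (hn : a ≤ b + 1 - n) :
    ∃ (g : ∀ i, P₃ i →ₗ[R] M₂ i) (θ : ∀ i, P₃ i →ₗ[R] P₁ (i + 1)),
      ∀ i, b + 1 - n ≤ i → ∀ q : P₃ i,
        β i (g i q) = π ^ (2 * n) • f₃ i q ∧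
        dM₂ i (g i q) = α (i + 1) (f₁ (i + 1) (θ i q)) + g (i + 1) (dP₃ i q) ∧
        dP₁ (i + 1) (θ i q) = - θ (i + 1) (dP₃ i q) := by
  induction n with
  | zero =>
    refine ⟨fun _ => 0, fun _ => 0, fun i hi q => ?_⟩
    have : q = 0 := hb i (by push_cast at hi; omega) q
    simp [this]
  | succ n ih =>
    obtain ⟨g, θ, h⟩ := ih (by push_cast at hn; omega)
    obtain ⟨i, hi⟩ : ∃ i : ℤ, i = b - n := ⟨_, rfl⟩
    push_cast at hn
    have hstep := pc_step π (π ^ (2 * n)) i ddP₃ ddM₁ ddM₂ cf₁ cf₃ cα cβ hα hαβ hβ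
      (inj _ (by omega)) (surj _ (by omega)) g θ (fun q => (h (i + 1) (by omega) q).1)
      (fun q => (h (i + 1) (by omega) q).2.1) (fun q => (h (i + 1) (by omega) q).2.2)
    have := hproj i
    obtain ⟨φ, hφ⟩ := pc_exists_lift
      (((π ^ 2 * π ^ (2 * n)) • f₃ i).prod
        ((π ^ 2 • (g (i + 1)).comp (dP₃ i)).prod (- (π ^ 2 • (θ (i + 1)).comp (dP₃ i)))))
      (X := P₁ (i + 1) × M₂ i)
      (((β i).comp (LinearMap.snd R _ _)).prod
        (((dM₂ i).comp (LinearMap.snd R _ _) -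
          ((α (i + 1)).comp (f₁ (i + 1))).comp (LinearMap.fst R _ _)).prod
          ((dP₁ (i + 1)).comp (LinearMap.fst R _ _)))) (by
        intro q
        obtain ⟨t, y, e1, e2, e3⟩ := hstep q
        refine ⟨(t, y), ?_⟩
        simp [e1, e2, e3])
    refine ⟨Function.update (fun j => π ^ 2 • g j) i ((LinearMap.snd R _ _).comp φ),
      Function.update (fun j => π ^ 2 • θ j) i ((LinearMap.fst R _ _).comp φ), ?_⟩
    intro j hj q
    push_cast at hj
    have hne : j + 1 ≠ i := by omega
    rw [Function.update_of_ne hne, Function.update_of_ne hne]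
    by_cases hji : j = i
    · subst hji
      have e := hφ q
      simp only [LinearMap.prod_apply, Function.prod_apply, Prod.mk.injEq, LinearMap.sub_apply,
        LinearMap.comp_apply, LinearMap.neg_apply, LinearMap.smul_apply,
        LinearMap.fst_apply, LinearMap.snd_apply] at e
      rw [Function.update_self, Function.update_self]
      refine ⟨?_, ?_, ?_⟩
      · rw [LinearMap.comp_apply, LinearMap.snd_apply, e.1, ← pow_add]
        congr 2; ring
      · rw [LinearMap.comp_apply, LinearMap.snd_apply, LinearMap.comp_apply, LinearMap.fst_apply,
          LinearMap.smul_apply, ← e.2.1]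
        abel
      · rw [LinearMap.comp_apply, LinearMap.fst_apply, e.2.2]; rfl
    · rw [Function.update_of_ne hji, Function.update_of_ne hji]
      obtain ⟨e1, e2, e3⟩ := h j (by omega) q
      simp only [LinearMap.smul_apply, map_smul, e1, e2, e3, smul_add, smul_neg, and_true]
      rw [smul_smul, ← pow_add]
      congr 2; ring

theorem pc_surj (π c : R) (i : ℤ)
    (ddM₂ : ∀ i x, dM₂ (i + 1) (dM₂ i x) = 0)
    (cf₁ : ∀ i x, f₁ (i + 1) (dP₁ i x) = dM₁ i (f₁ i x))
    (cα : ∀ i x, α (i + 1) (dM₁ i x) = dM₂ i (α i x))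
    (cβ : ∀ i x, β (i + 1) (dM₂ i x) = dM₃ i (β i x))
    (hα : ∀ i, Function.Injective (α i)) (hαβ : ∀ i, Function.Exact (α i) (β i))
    (hβ : ∀ i, Function.Surjective (β i))
    (inj₁ : PcInj π dP₁ dM₁ f₁ (i + 1)) (surj₁ : PcSurj π dP₁ dM₁ f₁ i)
    (surj₃ : PcSurj π dP₃ dM₃ f₃ i)
    (g : ∀ i, P₃ i →ₗ[R] M₂ i) (θ : ∀ i, P₃ i →ₗ[R] P₁ (i + 1))
    (h1 : ∀ i q, β i (g i q) = c • f₃ i q)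
    (h2 : ∀ i q, dM₂ i (g i q) = α (i + 1) (f₁ (i + 1) (θ i q)) + g (i + 1) (dP₃ i q))
    (h3 : ∀ i q, dP₁ (i + 1) (θ i q) = - θ (i + 1) (dP₃ i q))
    (m : M₂ (i + 1)) (hm : dM₂ (i + 1) m = 0) :
    ∃ (p : P₁ (i + 1)) (q : P₃ (i + 1)), dP₃ (i + 1) q = 0 ∧
      dP₁ (i + 1) p + θ (i + 1) q = 0 ∧
      ∃ n : M₂ i, (c * π ^ 3) • m = α (i + 1) (f₁ (i + 1) p) + g (i + 1) q + dM₂ i n := by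
  obtain ⟨q, hq, n₃, hn₃⟩ := surj₃ (β (i + 1) m) (by rw [← cβ, hm, map_zero])
  obtain ⟨n₂, rfl⟩ := hβ i n₃
  obtain ⟨m₁, hm₁⟩ := (hαβ (i + 1) ((c * π) • m - g (i + 1) q - c • dM₂ i n₂)).1 (by
    rw [map_sub, map_sub, map_smul, map_smul, h1, cβ, mul_smul, hn₃, smul_add]; abel)
  have hz : dP₁ (i + 1 + 1) (θ (i + 1) q) = 0 := by
    rw [h3, hq, map_zero, neg_zero]
  have hdm₁ : dM₁ (i + 1) m₁ = - f₁ (i + 1 + 1) (θ (i + 1) q) := by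
    apply hα
    rw [cα, hm₁, map_sub, map_sub, map_smul, map_smul, ddM₂, h2, hm, hq, map_zero, map_neg]
    simp
  obtain ⟨w, hw⟩ := inj₁ _ hz (-m₁) (by rw [map_neg, hdm₁, neg_neg])
  obtain ⟨p, hp, n', hn'⟩ := surj₁ (π • m₁ + f₁ (i + 1) w) (by
    rw [map_add, map_smul, ← cf₁, ← hw, hdm₁, map_smul, smul_neg, neg_add_cancel])
  refine ⟨p - π • w, π ^ 2 • q, ?_, ?_, (π ^ 2 * c) • n₂ + α i n', ?_⟩
  · rw [map_smul, hq, smul_zero]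
  · rw [map_sub, hp, map_smul, map_smul, ← hw, smul_smul, pow_two, zero_sub, neg_add_cancel]
  · have e' := congrArg (α (i + 1)) hn'
    simp only [map_add, map_smul, smul_add, hm₁, cα] at e'
    simp only [map_sub, map_add, map_smul]
    linear_combination (norm := module) e'

theorem pc_inj (π c : R) (i : ℤ)
    (ddM₂ : ∀ i x, dM₂ (i + 1) (dM₂ i x) = 0)
    (cf₃ : ∀ i x, f₃ (i + 1) (dP₃ i x) = dM₃ i (f₃ i x))
    (cα : ∀ i x, α (i + 1) (dM₁ i x) = dM₂ i (α i x))
    (cβ : ∀ i x, β (i + 1) (dM₂ i x) = dM₃ i (β i x))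
    (hα : ∀ i, Function.Injective (α i)) (hαβ : ∀ i, Function.Exact (α i) (β i))
    (hβ : ∀ i, Function.Surjective (β i))
    (inj₁ : PcInj π dP₁ dM₁ f₁ (i + 1))
    (inj₃ : PcInj π dP₃ dM₃ f₃ (i + 1))
    (surj₃ : PcSurj π dP₃ dM₃ f₃ i)
    (g : ∀ i, P₃ i →ₗ[R] M₂ i) (θ : ∀ i, P₃ i →ₗ[R] P₁ (i + 1))
    (h1 : ∀ i q, β i (g i q) = c • f₃ i q)
    (h2 : ∀ i q, dM₂ i (g i q) = α (i + 1) (f₁ (i + 1) (θ i q)) + g (i + 1) (dP₃ i q))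
    (h3 : ∀ i q, dP₁ (i + 1) (θ i q) = - θ (i + 1) (dP₃ i q))
    (p : P₁ (i + 1 + 1)) (q : P₃ (i + 1 + 1)) (hq : dP₃ (i + 1 + 1) q = 0)
    (hp : dP₁ (i + 1 + 1) p + θ (i + 1 + 1) q = 0) (m : M₂ (i + 1))
    (hm : α (i + 1 + 1) (f₁ (i + 1 + 1) p) + g (i + 1 + 1) q = dM₂ (i + 1) m) :
    ∃ (p' : P₁ (i + 1)) (q' : P₃ (i + 1)),
      (c ^ 2 * π ^ 3) • p = dP₁ (i + 1) p' + θ (i + 1) q' ∧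
      (c ^ 2 * π ^ 3) • q = dP₃ (i + 1) q' := by
  obtain ⟨q', hq'⟩ := inj₃ (c • q) (by rw [map_smul, hq, smul_zero]) (β (i + 1) m) (by
    rw [← cβ, ← hm, map_add, (hαβ _).apply_apply_eq_zero, h1, map_smul, zero_add])
  have hdm' : dM₂ (i + 1) ((π * c) • m - g (i + 1) q') =
      α (i + 1 + 1) (f₁ (i + 1 + 1) ((π * c) • p - θ (i + 1) q')) := by
    rw [map_sub, map_smul, ← hm, h2, ← hq']
    simp only [map_sub, map_smul]
    module
  have hp' : dP₁ (i + 1 + 1) ((π * c) • p - θ (i + 1) q') = 0 := by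
    rw [map_sub, map_smul, h3, ← hq', map_smul, map_smul]
    linear_combination (norm := module) (π * c) • hp
  generalize (π * c) • m - g (i + 1) q' = m' at hdm'
  obtain ⟨p', ep'⟩ : ∃ p', p' = (π * c) • p - θ (i + 1) q' := ⟨_, rfl⟩
  rw [← ep'] at hdm' hp'
  obtain ⟨q'', hq'', n₃, hn₃⟩ := surj₃ (β (i + 1) m') (by
    rw [← cβ, hdm', (hαβ _).apply_apply_eq_zero])
  obtain ⟨n₂, rfl⟩ := hβ i n₃
  obtain ⟨m₁, hm₁⟩ := (hαβ (i + 1) ((c * π) • m' - g (i + 1) q'' - c • dM₂ i n₂)).1 (by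
    rw [map_sub, map_sub, map_smul, map_smul, h1, cβ, mul_smul, hn₃, smul_add]; abel)
  obtain ⟨w, hw⟩ := inj₁ ((c * π) • p' - θ (i + 1) q'') (by
    rw [map_sub, map_smul, hp', h3, hq'', map_zero, smul_zero, neg_zero, sub_zero]) m₁ (by
    apply hα
    rw [cα, hm₁]
    simp only [map_sub, map_smul, ddM₂, h2, hq'', hdm', map_zero, smul_zero, add_zero, sub_zero])
  refine ⟨w, (c * π ^ 2) • q' + π • q'', ?_, ?_⟩
  · rw [← hw, ep', map_add, map_smul, map_smul]
    module
  · rw [map_add, map_smul, map_smul, ← hq', hq'']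
    module

end Core

section Bridge

universe v u'

variable {R : Type u'} [CommRing R]

theorem pc_homology_surj (K : CochainComplex (ModuleCat.{v} R) ℤ) (i : ℤ) (h : K.homology i) :
    ∃ z : K.cycles i, K.homologyπ i z = h :=
  (ModuleCat.epi_iff_surjective (K.homologyπ i)).1 inferInstance h

theorem pc_iCycles_inj (K : CochainComplex (ModuleCat.{v} R) ℤ) (i : ℤ) :
    Function.Injective (K.iCycles i) :=
  (ModuleCat.mono_iff_injective (K.iCycles i)).1 inferInstance

theorem pc_homology_zero (K : CochainComplex (ModuleCat.{v} R) ℤ) (i : ℤ)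
    (z : K.cycles (i + 1)) :
    K.homologyπ (i + 1) z = 0 ↔ ∃ y : K.X i, K.iCycles (i + 1) z = K.d i (i + 1) y := by
  have hex := (ShortComplex.exact_of_g_is_cokernel
    (ShortComplex.mk _ _ (K.toCycles_comp_homologyπ i (i + 1)))
    (K.homologyIsCokernel i (i + 1) (by simp)))
  rw [ShortComplex.moduleCat_exact_iff] at hex
  constructor
  · intro h
    obtain ⟨y, hy⟩ := hex z h
    refine ⟨y, ?_⟩
    rw [← hy]
    exact ConcreteCategory.congr_hom (K.toCycles_i i (i + 1)) y
  · rintro ⟨y, hy⟩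
    have : z = K.toCycles i (i + 1) y := by
      apply pc_iCycles_inj
      rw [hy]
      exact (ConcreteCategory.congr_hom (K.toCycles_i i (i + 1)) y).symm
    rw [this]
    exact ConcreteCategory.congr_hom (K.toCycles_comp_homologyπ i (i + 1)) y

theorem pc_cycles (K : CochainComplex (ModuleCat.{v} R) ℤ) (i : ℤ) (x : K.X i)
    (hx : K.d i (i + 1) x = 0) : ∃ z : K.cycles i, K.iCycles i z = x := by
  have hex := (ShortComplex.exact_of_f_is_kernel
    (ShortComplex.mk _ _ (K.iCycles_d i (i + 1)))
    (K.cyclesIsKernel i (i + 1) (by simp)))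
  rw [ShortComplex.moduleCat_exact_iff] at hex
  exact hex x hx

theorem pc_cycles_d (K : CochainComplex (ModuleCat.{v} R) ℤ) (i : ℤ) (z : K.cycles i) :
    K.d i (i + 1) (K.iCycles i z) = 0 :=
  ConcreteCategory.congr_hom (K.iCycles_d i (i + 1)) z

variable {P M : CochainComplex (ModuleCat.{v} R) ℤ} (f : P ⟶ M) (r : R) (i : ℤ)

theorem pc_map_π (z : P.cycles i) : HomologicalComplex.homologyMap f i (P.homologyπ i z) =
    M.homologyπ i (HomologicalComplex.cyclesMap f i z) :=
  ConcreteCategory.congr_hom (HomologicalComplex.homologyπ_naturality f i) z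

theorem pc_map_i (z : P.cycles i) : M.iCycles i (HomologicalComplex.cyclesMap f i z) =
    f.f i (P.iCycles i z) :=
  ConcreteCategory.congr_hom (HomologicalComplex.cyclesMap_i f i) z

theorem pc_inj_iff :
    (∀ x, HomologicalComplex.homologyMap f (i + 1) x = 0 → r • x = 0) ↔
    PcInj r (fun i => (P.d i (i + 1)).hom) (fun i => (M.d i (i + 1)).hom)
      (fun i => (f.f i).hom) i := by
  constructor
  · intro h z hz n hn
    obtain ⟨z, rfl⟩ := pc_cycles P _ z hz
    have := h (P.homologyπ _ z) (by
      rw [pc_map_π, pc_homology_zero, pc_map_i]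
      exact ⟨n, hn⟩)
    rw [← map_smul, pc_homology_zero] at this
    obtain ⟨y, hy⟩ := this
    refine ⟨y, ?_⟩
    rw [map_smul] at hy
    exact hy
  · intro h x hx
    obtain ⟨z, rfl⟩ := pc_homology_surj P _ x
    rw [pc_map_π, pc_homology_zero, pc_map_i] at hx
    obtain ⟨n, hn⟩ := hx
    obtain ⟨w, hw⟩ := h (P.iCycles _ z) (pc_cycles_d P _ z) n hn
    rw [← map_smul, pc_homology_zero]
    refine ⟨w, ?_⟩
    rw [map_smul]
    exact hw

theorem pc_surj_iff :
    (∀ y, ∃ x, r • y = HomologicalComplex.homologyMap f (i + 1) x) ↔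
    PcSurj r (fun i => (P.d i (i + 1)).hom) (fun i => (M.d i (i + 1)).hom)
      (fun i => (f.f i).hom) i := by
  constructor
  · intro h m hm
    obtain ⟨m, rfl⟩ := pc_cycles M _ m hm
    obtain ⟨x, hx⟩ := h (M.homologyπ _ m)
    obtain ⟨z, rfl⟩ := pc_homology_surj P _ x
    rw [pc_map_π, ← map_smul, ← sub_eq_zero, ← map_sub, pc_homology_zero, map_sub, pc_map_i,
      map_smul] at hx
    obtain ⟨n, hn⟩ := hx
    exact ⟨P.iCycles _ z, pc_cycles_d P _ z, n, (sub_eq_iff_eq_add'.1 hn)⟩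
  · intro h y
    obtain ⟨m, rfl⟩ := pc_homology_surj M _ y
    obtain ⟨z, hz, n, hn⟩ := h (M.iCycles _ m) (pc_cycles_d M _ m)
    obtain ⟨z, rfl⟩ := pc_cycles P _ z hz
    refine ⟨P.homologyπ _ z, ?_⟩
    rw [pc_map_π, ← map_smul, ← sub_eq_zero, ← map_sub, pc_homology_zero, map_sub, pc_map_i,
      map_smul]
    exact ⟨n, sub_eq_iff_eq_add'.2 hn⟩

end Bridge

universe u

/-- **Proposition 4.7(2).** There is an integer `l ≥ 0` depending only on `b - a` such that:
for every commutative ring `R`, every `π ∈ R`, and every short exact sequence of cochain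
complexes of `R`-modules `0 → M₁^• → M₂^• → M₃^• → 0` (exact in each degree), if `M₁^•` and
`M₃^•` are `π`-`[a,b]`-pseudo-coherent, then `M₂^•` is `π^l`-`[a,b]`-pseudo-coherent. -/
theorem isPiPseudoCoherent_of_shortExact_middle :
    ∃ l : ℤ → ℕ, ∀ (a b : ℤ), a ≤ b →
      ∀ (R : Type u) [CommRing R] (π : R) (M₁ M₂ M₃ : CochainComplex (ModuleCat R) ℤ)
        (α : M₁ ⟶ M₂) (β : M₂ ⟶ M₃),
        (∀ i : ℤ, Function.Injective (α.f i)) →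
        (∀ i : ℤ, Function.Exact (α.f i) (β.f i)) →
        (∀ i : ℤ, Function.Surjective (β.f i)) →
        IsPiPseudoCoherent π a b M₁ →
        IsPiPseudoCoherent π a b M₃ →
        IsPiPseudoCoherent (π ^ l (b - a)) a b M₂ := by
  refine ⟨fun d => 4 * (d + 1).toNat + 3, ?_⟩
  intro a b hab R _ π M₁ M₂ M₃ α β hα hαβ hβ
  rintro ⟨hM₁, P₁, f₁, free₁, fin₁, van₁, iso₁, sur₁⟩ ⟨hM₃, P₃, f₃, free₃, fin₃, van₃, iso₃, sur₃⟩
  refine ⟨fun i hi x => ?_, ?_⟩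
  · obtain ⟨y, rfl⟩ := (hαβ i x).1 (hM₃ i hi _)
    rw [hM₁ i hi y, map_zero]
  -- elementwise forms of the hypotheses
  have inj₁ := fun i (hi : a ≤ i) => (pc_inj_iff f₁ π i).1 (iso₁ (i + 1) (by omega)).1
  have inj₃ := fun i (hi : a ≤ i) => (pc_inj_iff f₃ π i).1 (iso₃ (i + 1) (by omega)).1
  have surj₁ : ∀ i, a ≤ i + 1 → PcSurj π (fun i => (P₁.d i (i + 1)).hom)
      (fun i => (M₁.d i (i + 1)).hom) (fun i => (f₁.f i).hom) i := fun i hi => by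
    refine (pc_surj_iff f₁ π i).1 ?_
    rcases hi.eq_or_lt with h | h
    · subst h; exact sur₁
    · exact (iso₁ (i + 1) h).2
  have surj₃ : ∀ i, a ≤ i + 1 → PcSurj π (fun i => (P₃.d i (i + 1)).hom)
      (fun i => (M₃.d i (i + 1)).hom) (fun i => (f₃.f i).hom) i := fun i hi => by
    refine (pc_surj_iff f₃ π i).1 ?_
    rcases hi.eq_or_lt with h | h
    · subst h; exact sur₃
    · exact (iso₃ (i + 1) h).2
  have dd : ∀ (K : CochainComplex (ModuleCat R) ℤ) (i : ℤ) (x : K.X i),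
      (K.d (i + 1) (i + 1 + 1)).hom ((K.d i (i + 1)).hom x) = 0 := fun K i x =>
    ConcreteCategory.congr_hom (K.d_comp_d i (i + 1) (i + 1 + 1)) x
  have cm : ∀ {K L : CochainComplex (ModuleCat R) ℤ} (φ : K ⟶ L) (i : ℤ) (x : K.X i),
      (φ.f (i + 1)).hom ((K.d i (i + 1)).hom x) = (L.d i (i + 1)).hom ((φ.f i).hom x) :=
    fun φ i x => (ConcreteCategory.congr_hom (φ.comm i (i + 1)) x).symm
  obtain ⟨N, hN⟩ : ∃ N : ℕ, N = (b - a + 1).toNat := ⟨_, rfl⟩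
  have hN' : (N : ℤ) = b - a + 1 := by omega
  obtain ⟨g, θ, h⟩ := pc_build (dP₁ := fun i => (P₁.d i (i + 1)).hom)
    (dP₃ := fun i => (P₃.d i (i + 1)).hom) (dM₁ := fun i => (M₁.d i (i + 1)).hom)
    (dM₂ := fun i => (M₂.d i (i + 1)).hom) (dM₃ := fun i => (M₃.d i (i + 1)).hom)
    (f₁ := fun i => (f₁.f i).hom) (f₃ := fun i => (f₃.f i).hom)
    (α := fun i => (α.f i).hom) (β := fun i => (β.f i).hom)
    π a b (fun i => by have := free₃ i; infer_instance) (fun i hi => van₃ i (Or.inr hi))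
    (dd P₃) (dd M₁) (dd M₂) (cm f₁) (cm f₃) (cm α) (cm β) hα hαβ hβ inj₁ surj₁ N (by omega)
  have h' : ∀ i (q : P₃.X i),
      (β.f i).hom (g i q) = π ^ (2 * N) • (f₃.f i).hom q ∧
      (M₂.d i (i + 1)).hom (g i q) = (α.f (i + 1)).hom ((f₁.f (i + 1)).hom (θ i q)) +
        g (i + 1) ((P₃.d i (i + 1)).hom q) ∧
      (P₁.d (i + 1) (i + 1 + 1)).hom (θ i q) = - θ (i + 1) ((P₃.d i (i + 1)).hom q) := by
    intro i q
    rcases lt_or_ge i a with hi | hi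
    · rw [van₃ i (Or.inl hi) q]; simp
    · exact h i (by omega) q
  clear h
  let d₂ : ∀ i, (P₁.X i × P₃.X i) →ₗ[R] (P₁.X (i + 1) × P₃.X (i + 1)) := fun i =>
    (((P₁.d i (i + 1)).hom.comp (LinearMap.fst R _ _)) + (θ i).comp (LinearMap.snd R _ _)).prod
      ((P₃.d i (i + 1)).hom.comp (LinearMap.snd R _ _))
  let F₂ : ∀ i, (P₁.X i × P₃.X i) →ₗ[R] M₂.X i := fun i =>
    ((α.f i).hom.comp (f₁.f i).hom).comp (LinearMap.fst R _ _) + (g i).comp (LinearMap.snd R _ _)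
  have d₂_apply : ∀ i p q, d₂ i (p, q) =
    ((P₁.d i (i + 1)).hom p + θ i q, (P₃.d i (i + 1)).hom q) := fun _ _ _ => rfl
  have F₂_apply : ∀ i p q, F₂ i (p, q) = (α.f i).hom ((f₁.f i).hom p) + g i q :=
    fun _ _ _ => rfl
  let P₂ : CochainComplex (ModuleCat R) ℤ := CochainComplex.of
    (fun i => ModuleCat.of R (P₁.X i × P₃.X i)) (fun i => ModuleCat.ofHom (d₂ i)) (by
      intro i
      ext1
      refine LinearMap.ext ?_
      rintro ⟨p, q⟩
      change d₂ (i + 1) (d₂ i (p, q)) = 0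
      rw [d₂_apply, d₂_apply, map_add, dd, dd, (h' i q).2.2]
      simp)
  have P₂_d : ∀ i, P₂.d i (i + 1) = ModuleCat.ofHom (d₂ i) := fun i =>
    CochainComplex.of_d (fun i => ModuleCat.of R (P₁.X i × P₃.X i))
      (fun i => ModuleCat.ofHom (d₂ i)) i
  let f₂ : P₂ ⟶ M₂ :=
    { f := fun i => ModuleCat.ofHom (F₂ i)
      comm' := by
        rintro i j (rfl : i + 1 = j)
        rw [P₂_d]
        ext1
        refine LinearMap.ext ?_
        rintro ⟨p, q⟩
        change (M₂.d i (i + 1)).hom (F₂ i (p, q)) = F₂ (i + 1) (d₂ i (p, q))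
        rw [d₂_apply, F₂_apply, F₂_apply, map_add, (h' i q).2.1, map_add, map_add, cm f₁, cm α]
        abel }
  have surj₂ : ∀ i, a ≤ i + 1 → PcSurj (π ^ (4 * N + 3)) (fun i => (P₂.d i (i + 1)).hom)
      (fun i => (M₂.d i (i + 1)).hom) (fun i => (f₂.f i).hom) i := by
    intro i hi m hm
    obtain ⟨p, q, hq, hp, n, hn⟩ := pc_surj π (π ^ (2 * N)) i (dd M₂) (cm f₁) (cm α) (cm β)
      hα hαβ hβ (inj₁ _ (by omega)) (surj₁ _ hi) (surj₃ _ hi) g θ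
      (fun i q => (h' i q).1) (fun i q => (h' i q).2.1) (fun i q => (h' i q).2.2) m hm
    refine ⟨π ^ (2 * N) • ((p, q) : P₁.X (i + 1) × P₃.X (i + 1)), ?_, π ^ (2 * N) • n, ?_⟩
    · simp only [P₂_d]
      change d₂ (i + 1) (π ^ (2 * N) • (p, q)) = 0
      rw [map_smul, d₂_apply, hp, hq]
      simp
    · change π ^ (4 * N + 3) • m = F₂ (i + 1) (π ^ (2 * N) • (p, q)) + (M₂.d i (i + 1)).hom _
      rw [map_smul, map_smul, F₂_apply, ← smul_add, ← hn, smul_smul]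
      congr 1; ring
  have inj₂ : ∀ i, a ≤ i → PcInj (π ^ (4 * N + 3)) (fun i => (P₂.d i (i + 1)).hom)
      (fun i => (M₂.d i (i + 1)).hom) (fun i => (f₂.f i).hom) i := by
    intro i hi
    obtain ⟨i, rfl⟩ : ∃ j, i = j + 1 := ⟨i - 1, by omega⟩
    rintro ⟨p, q⟩ hz n hn
    simp only [P₂_d] at hz
    replace hz : d₂ (i + 1 + 1) (p, q) = 0 := hz
    rw [d₂_apply, Prod.mk_eq_zero] at hz
    obtain ⟨p', q', e1, e2⟩ := pc_inj π (π ^ (2 * N)) i (dd M₂) (cm f₃) (cm α) (cm β)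
      hα hαβ hβ (inj₁ _ hi) (inj₃ _ hi) (surj₃ _ hi) g θ
      (fun i q => (h' i q).1) (fun i q => (h' i q).2.1) (fun i q => (h' i q).2.2) p q hz.2 hz.1
      n hn
    have e : (π ^ (2 * N)) ^ 2 * π ^ 3 = π ^ (4 * N + 3) := by ring
    rw [e] at e1 e2
    refine ⟨((p', q') : P₁.X (i + 1) × P₃.X (i + 1)), ?_⟩
    simp only [P₂_d]
    change π ^ (4 * N + 3) • (p, q) = d₂ (i + 1) (p', q')
    rw [d₂_apply, Prod.smul_mk, e1, e2]
  change ∃ (P : CochainComplex (ModuleCat R) ℤ) (f : P ⟶ M₂),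
    IsPiPseudoResolution (π ^ (4 * (b - a + 1).toNat + 3)) a b f
  rw [← hN]
  refine ⟨P₂, f₂, fun i => ?_, fun i => ?_, fun i hi x => ?_, fun i hi => ?_, ?_⟩
  · have := free₁ i
    have := free₃ i
    exact (inferInstance : Module.Free R (P₁.X i × P₃.X i))
  · have := fin₁ i
    have := fin₃ i
    exact (inferInstance : Module.Finite R (P₁.X i × P₃.X i))
  · exact Prod.ext (van₁ i hi _) (van₃ i hi _)
  · obtain ⟨i, rfl⟩ : ∃ j, i = j + 1 := ⟨i - 1, by omega⟩
    exact ⟨(pc_inj_iff f₂ _ i).2 (inj₂ i (by omega)),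
      (pc_surj_iff f₂ _ i).2 (surj₂ i (by omega))⟩
  · obtain ⟨i, rfl⟩ : ∃ j, a = j + 1 := ⟨a - 1, by omega⟩
    exact (pc_surj_iff f₂ _ i).2 (surj₂ i le_rfl)
end

section
/- Let a ≤ b be integers. There exists an integer l ≥ 0 depending only on b−a such that: for every commutative ring R, every π ∈ R, and every cochain complex M^• of R-modules vanishing in degrees > b, if for every i ∈ [a,b] the cohomology module H^i(M^•), regarded as a complex concentrated in degree 0, is π-[a−i,b−i]-pseudo-coherent, then M^• is π^l-[a,b]-pseudo-coherent. -/
open CategoryTheory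

universe u

universe v

/-- Auxiliary unbundled cochain complexes. -/
structure Cx (R : Type u) [CommRing R] where
  X : ℤ → Type v
  [acg : ∀ i, AddCommGroup (X i)]
  [mod : ∀ i, Module R (X i)]
  d : ∀ i, X i →ₗ[R] X (i + 1)
  dd : ∀ i x, d (i + 1) (d i x) = 0

attribute [instance] Cx.acg Cx.mod

namespace Cx

variable {R : Type u} [CommRing R]

/-- Chain maps. -/
structure Hm (P M : Cx.{u, v} R) where
  f : ∀ i, P.X i →ₗ[R] M.X i
  comm : ∀ i x, M.d i (f i x) = f (i + 1) (P.d i x)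

/-- The cone of a chain map. -/
def cone {P M : Cx.{u, v} R} (f : Hm P M) : Cx.{u, v} R where
  X i := M.X i × P.X (i + 1)
  d i :=
    { toFun := fun z => (M.d i z.1 + f.f (i + 1) z.2, - P.d (i + 1) z.2)
      map_add' := by
        intro x y
        simp only [Prod.fst_add, Prod.snd_add, map_add, Prod.mk_add_mk, Prod.mk.injEq]
        constructor <;> abel
      map_smul' := by
        intro r x
        simp }
  dd := by
    intro i x
    simp [M.dd, P.dd, f.comm]

@[simp] lemma cone_d {P M : Cx.{u, v} R} (f : Hm P M) (i : ℤ) (z : M.X i × P.X (i + 1)) :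
    (cone f).d i z = (M.d i z.1 + f.f (i + 1) z.2, - P.d (i + 1) z.2) := rfl

/-- Elements of the cone. -/
def mkc {P M : Cx.{u, v} R} (f : Hm P M) (i : ℤ) (m : M.X i) (p : P.X (i + 1)) : (cone f).X i :=
  (m, p)

/-- The invariant of the induction. -/
structure Inv (π : R) (a c : ℤ) (k : ℕ) (M C : Cx.{u, v} R) (j : ∀ i, M.X i →ₗ[R] C.X i) :
    Prop where
  one : ∀ i, a ≤ i + 1 → i + 1 < c → ∀ z : C.X (i + 1), C.d _ z = 0 →
    ∃ y, C.d i y = π ^ k • z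
  two : ∀ i, c ≤ i + 1 → ∀ z : C.X (i + 1), C.d _ z = 0 →
    ∃ m y, M.d (i + 1) m = 0 ∧ π ^ k • z = j (i + 1) m + C.d i y
  three : ∀ i, c ≤ i + 1 → ∀ m : M.X (i + 1), M.d _ m = 0 → ∀ y, j _ m = C.d i y →
    ∃ w, m = M.d i w

/-- Elementwise resolution data of the cohomology of `M` in degree `c`. -/
structure Res (π : R) (a c : ℤ) (M Q : Cx.{u, v} R) (e : ∀ i, Q.X i →ₗ[R] M.X i) : Prop where
  e_zero : ∀ i, i ≠ c → e i = 0
  cyc : ∀ i x, M.d i (e i x) = 0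
  bd : ∀ i x, ∃ y, M.d i y = e (i + 1) (Q.d i x)
  surj : ∀ i, i + 1 = c → ∀ m, M.d (i + 1) m = 0 → ∃ q y, Q.d (i + 1) q = 0 ∧
    π • m = e (i + 1) q + M.d i y
  inj : ∀ i, i + 1 = c → a < i + 1 → ∀ q, Q.d (i + 1) q = 0 → (∃ y, e (i + 1) q = M.d i y) →
    ∃ q', π • q = Q.d i q'
  kill : ∀ i, i + 1 ≠ c → a < i + 1 → ∀ q, Q.d (i + 1) q = 0 → ∃ q', π • q = Q.d i q'

lemma proj_lift {P A B : Type*} [AddCommGroup P] [Module R P] [AddCommGroup A] [Module R A]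
    [AddCommGroup B] [Module R B] [Module.Projective R P] (f : A →ₗ[R] B) (g : P →ₗ[R] B)
    (h : ∀ x, ∃ y, f y = g x) : ∃ l : P →ₗ[R] A, ∀ x, f (l x) = g x := by
  obtain ⟨l, hl⟩ := Module.projective_lifting_property f.rangeRestrict
    (g.codRestrict (LinearMap.range f) (fun x => h x)) f.surjective_rangeRestrict
  refine ⟨l, fun x => ?_⟩
  have := congrArg Subtype.val (LinearMap.congr_fun hl x)
  exact this

lemma lift_aux (π : R) (a c : ℤ) (k : ℕ) (C Q : Cx.{u, v} R)
    (h1 : ∀ i, a ≤ i + 1 → i + 1 < c → ∀ z : C.X (i + 1), C.d _ z = 0 →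
      ∃ y, C.d i y = π ^ k • z)
    (hproj : ∀ i, Module.Projective R (Q.X i))
    (e : ∀ i, Q.X i →ₗ[R] C.X i) (e_zero : ∀ i, i ≠ c → e i = 0)
    (cyc : ∀ i x, C.d i (e i x) = 0) (bd : ∀ i x, ∃ y, C.d i y = e (i + 1) (Q.d i x))
    (n : ℕ) (hn : (n : ℤ) ≤ c - a) :
    ∃ h : ∀ i, Q.X i →ₗ[R] C.X i, (∀ i, c - n ≤ i → ∀ x, C.d i (h i x) = h (i + 1) (Q.d i x)) ∧
      (∀ i, c ≤ i → h i = π ^ (k * n) • e i) := by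
  induction n with
  | zero =>
    refine ⟨e, ?_, by simp⟩
    intro i hi x
    rw [cyc, e_zero (i + 1) (by simp at hi; omega)]; rfl
  | succ n ih =>
    obtain ⟨h, hc, he⟩ := ih (by push_cast at hn; omega)
    obtain ⟨j, hj⟩ : ∃ j, j = c - n - 1 := ⟨_, rfl⟩
    obtain ⟨l, hl⟩ := proj_lift (C.d j) (π ^ k • (h (j + 1) ∘ₗ Q.d j)) (by
      intro x
      by_cases h0 : j + 1 = c
      · obtain ⟨y, hy⟩ := bd j x
        refine ⟨π ^ k • π ^ (k * n) • y, ?_⟩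
        simp [he (j + 1) (by omega), hy]
      · refine h1 j (by push_cast at hn; omega) (by omega) _ ?_
        simp only [LinearMap.comp_apply]
        rw [hc (j + 1) (by omega), Q.dd, map_zero])
    refine ⟨Function.update (fun i => π ^ k • h i) j l, ?_, ?_⟩
    · intro i hi x
      rw [Function.update_of_ne (a := i + 1) (by push_cast at hi; omega)]
      by_cases hij : i = j
      · subst hij
        rw [Function.update_self, hl]; rfl
      · rw [Function.update_of_ne hij]
        simp only [LinearMap.smul_apply, map_smul]
        rw [hc i (by push_cast at hi; omega)]
    · intro i hi
      rw [Function.update_of_ne (by omega)]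
      simp only [he i hi, smul_smul]
      congr 1
      ring

lemma exists_lift (π : R) (a c : ℤ) (hac : a ≤ c) (k : ℕ) (C Q : Cx.{u, v} R)
    (h1 : ∀ i, a ≤ i + 1 → i + 1 < c → ∀ z : C.X (i + 1), C.d _ z = 0 →
      ∃ y, C.d i y = π ^ k • z)
    (hproj : ∀ i, Module.Projective R (Q.X i)) (hQ : ∀ i, i < a → ∀ x : Q.X i, x = 0)
    (e : ∀ i, Q.X i →ₗ[R] C.X i) (e_zero : ∀ i, i ≠ c → e i = 0)
    (cyc : ∀ i x, C.d i (e i x) = 0) (bd : ∀ i x, ∃ y, C.d i y = e (i + 1) (Q.d i x)) :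
    ∃ h : Hm Q C, (∀ i, c ≤ i → h.f i = π ^ (k * (c - a).toNat) • e i) := by
  obtain ⟨h, hc, he⟩ := lift_aux π a c k C Q h1 hproj e e_zero cyc bd (c - a).toNat (by omega)
  refine ⟨⟨h, fun i x => ?_⟩, he⟩
  by_cases hi : a ≤ i
  · exact hc i (by omega) x
  · rw [hQ i (by omega) x]; simp

lemma pow_bd {A B : Type*} [AddCommGroup A] [Module R A] [AddCommGroup B] [Module R B]
    (f : A →ₗ[R] B) (π : R) {s t : ℕ} (hst : s ≤ t) {z : B} (h : ∃ y, f y = π ^ s • z) :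
    ∃ y, f y = π ^ t • z := by
  obtain ⟨y, hy⟩ := h
  refine ⟨π ^ (t - s) • y, ?_⟩
  rw [map_smul, hy, smul_smul, ← pow_add, Nat.sub_add_cancel hst]

/-- Reduce a cocycle of the cone to one with vanishing second component. -/
lemma red (π : R) {C Q : Cx.{u, v} R} (h : Hm Q C) (i : ℤ) (z : (cone h).X (i + 1))
    (hz : (cone h).d _ z = 0) (s : ℕ) (hq : ∃ q', π ^ s • z.2 = Q.d (i + 1) q') :
    ∃ (w : C.X (i + 1)) (q' : Q.X (i + 1)), C.d _ w = 0 ∧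
      π ^ s • z = mkc h (i + 1) (w) (0) - (cone h).d i (mkc h i (0) (q')) := by
  obtain ⟨q', hq'⟩ := hq
  obtain ⟨z1, q⟩ := z
  have e1 : C.d (i + 1) z1 + h.f (i + 1 + 1) q = 0 := congrArg Prod.fst hz
  refine ⟨π ^ s • z1 + h.f _ q', q', ?_, ?_⟩
  · rw [map_add, h.comm, ← hq', map_smul, map_smul, ← smul_add, e1, smul_zero]
  · refine Prod.ext ?_ ?_
    · change π ^ s • z1 = (π ^ s • z1 + h.f _ q') - (C.d i 0 + h.f _ q')
      simp
    · change π ^ s • q = 0 - - Q.d _ q'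
      simpa using hq'

lemma step_inv (π : R) (a c : ℤ) (hac : a ≤ c) (k : ℕ) (M C Q : Cx.{u, v} R)
    (j : Hm M C) (hI : Inv π a c k M C j.f) (e : ∀ i, Q.X i →ₗ[R] M.X i) (hR : Res π a c M Q e)
    (h : Hm Q C) (N : ℕ) (hN : ∀ i, c ≤ i → ∀ x, h.f i x = π ^ N • j.f i (e i x)) :
    Inv π a (c + 1) (k + N + 2) M (cone h) (fun i => LinearMap.inl R _ _ ∘ₗ j.f i) := by
  have key1 : ∀ i, a ≤ i + 1 → i + 1 ≠ c - 1 → ∀ q : Q.X (i + 1 + 1), Q.d _ q = 0 →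
      ∃ q', π ^ 1 • q = Q.d (i + 1) q' := by
    intro i hi hc q hq
    rw [pow_one]
    exact hR.kill (i + 1) (by omega) (by omega) q hq
  have hd2 : ∀ i (z : (cone h).X (i + 1)), (cone h).d _ z = 0 → Q.d _ z.2 = 0 := by
    intro i z hz
    have := congrArg Prod.snd hz
    exact neg_eq_zero.mp this
  have hd1 : ∀ i (z : (cone h).X (i + 1)), (cone h).d _ z = 0 →
      C.d _ z.1 + h.f _ z.2 = 0 := fun i z hz => congrArg Prod.fst hz
  constructor
  · intro i hi hic z hz
    by_cases hc : i + 1 = c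
    · obtain ⟨w, q', hw, hz'⟩ := red π h i z hz 1 (key1 i hi (by omega) _ (hd2 i z hz))
      obtain ⟨m, y, hm, hmy⟩ := hI.two i (by omega) w hw
      obtain ⟨q, y', hq, hqy⟩ := hR.surj i hc m hm
      refine ⟨mkc h i (π ^ (N + 1) • y + π ^ N • j.f i y') (q) -
        π ^ (k + N + 1) • mkc h i (0) (q'), ?_⟩
      have : π ^ (k + N + 2) • z = π ^ (k + N + 1) • (π ^ 1 • z) := by
        rw [smul_smul, ← pow_add]
      rw [this, hz', map_sub, map_smul, smul_sub]
      congr 1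
      refine Prod.ext ?_ ?_
      · change C.d i (π ^ (N + 1) • y + π ^ N • j.f i y') + h.f _ q = π ^ (k + N + 1) • w
        have : π ^ (k + N + 1) • w = π ^ (N + 1) • (π ^ k • w) := by
          rw [smul_smul, ← pow_add]; congr 2; ring
        rw [this, hmy, hN _ (by omega), smul_add]
        have h2 : π ^ (N + 1) • j.f (i + 1) m = π ^ N • j.f (i + 1) (π • m) := by
          rw [map_smul, smul_smul, pow_succ]
        rw [h2, hqy, map_add (j.f (i + 1)), ← j.comm]
        simp only [map_add, map_smul, smul_add]
        abel
      · change - Q.d _ q = π ^ (k + N + 1) • 0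
        simp [hq]
    · have hq : ∃ q', π ^ (N + 1) • z.2 = Q.d (i + 1) q' := by
        by_cases hc2 : i + 1 + 1 = c
        · have hh := hd1 i z hz
          rw [hN _ (by omega), ← map_smul, ← map_smul] at hh
          obtain ⟨m', hm'⟩ := hI.three (i + 1) (by omega) (e _ (π ^ N • z.2)) (hR.cyc _ _)
            (- z.1) (by rw [map_neg]; exact eq_neg_of_add_eq_zero_right hh)
          obtain ⟨q', hq'⟩ := hR.inj (i + 1) hc2 (by omega) (π ^ N • z.2)
            (by rw [map_smul, hd2 i z hz, smul_zero]) ⟨m', hm'⟩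
          refine ⟨q', ?_⟩
          rw [← hq', smul_smul, pow_succ']
        · obtain ⟨q', hq'⟩ := key1 i hi (by omega) _ (hd2 i z hz)
          refine ⟨π ^ N • q', ?_⟩
          rw [map_smul, ← hq', smul_smul, ← pow_add]
      obtain ⟨w, q', hw, hz'⟩ := red π h i z hz _ hq
      obtain ⟨y, hy⟩ := hI.one i hi (by omega) w hw
      refine pow_bd ((cone h).d i) π (s := k + (N + 1)) (by omega) ?_
      refine ⟨mkc h i (y) (0) - π ^ k • mkc h i (0) (q'), ?_⟩
      rw [pow_add, mul_smul, hz', map_sub, map_smul, smul_sub]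
      congr 1
      refine Prod.ext ?_ ?_
      · change C.d i y + h.f _ 0 = π ^ k • w
        simp [hy]
      · change - Q.d _ 0 = π ^ k • 0
        simp
  · intro i hi z hz
    obtain ⟨w, q', hw, hz'⟩ := red π h i z hz 1 (key1 i (by omega) (by omega) _ (hd2 i z hz))
    obtain ⟨m, y, hm, hmy⟩ := hI.two i (by omega) w hw
    refine ⟨π ^ (N + 1) • m, π ^ (N + 1) • (mkc h i (y) (0) -
      π ^ k • mkc h i (0) (q')), by rw [map_smul, hm, smul_zero], ?_⟩
    have : π ^ (k + N + 2) • z = π ^ (N + 1) • π ^ k • (π ^ 1 • z) := by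
      rw [smul_smul, smul_smul, ← pow_add, ← pow_add]; congr 2; ring
    rw [this, hz', map_smul, map_smul, ← smul_add]
    congr 1
    rw [map_sub, map_smul, smul_sub, add_sub]
    congr 1
    refine Prod.ext ?_ ?_
    · change π ^ k • w = j.f _ m + (C.d i y + h.f _ 0)
      simp [hmy]
    · change π ^ k • 0 = 0 + - Q.d _ 0
      simp
  · intro i hi m hm y hy
    have e1 : j.f _ m = C.d i y.1 + h.f _ y.2 := congrArg Prod.fst hy
    rw [hN _ (by omega), hR.e_zero _ (by omega)] at e1
    exact hI.three i (by omega) m hm y.1 (by simpa using e1)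

/-- Total complex `P × Q` twisted by `h`. -/
def ext {P M Q : Cx.{u, v} R} (f : Hm P M) (h : Hm Q (cone f)) : Cx.{u, v} R where
  X i := P.X i × Q.X i
  d i :=
    { toFun := fun z => (P.d i z.1 - (h.f i z.2).2, Q.d i z.2)
      map_add' := by
        intro x y
        refine Prod.ext ?_ ?_
        · change P.d i (x.1 + y.1) - (h.f i (x.2 + y.2)).2 =
            (P.d i x.1 - (h.f i x.2).2) + (P.d i y.1 - (h.f i y.2).2)
          rw [map_add, map_add]
          change _ - ((h.f i x.2).2 + (h.f i y.2).2) = _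
          abel
        · exact map_add (Q.d i) _ _
      map_smul' := by
        intro r x
        refine Prod.ext ?_ ?_
        · change P.d i (r • x.1) - (h.f i (r • x.2)).2 = r • (P.d i x.1 - (h.f i x.2).2)
          rw [map_smul, map_smul, smul_sub]
          rfl
        · exact map_smul (Q.d i) _ _ }
  dd := by
    intro i x
    have := congrArg Prod.snd (h.comm i x.2)
    have t : - P.d (i + 1) (h.f i x.2).2 = (h.f (i + 1) (Q.d i x.2)).2 := this
    refine Prod.ext ?_ ?_
    · change P.d (i + 1) (P.d i x.1 - (h.f i x.2).2) - (h.f (i + 1) (Q.d i x.2)).2 = 0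
      rw [← t, map_sub, P.dd]
      abel
    · exact Q.dd i x.2

/-- The map from the extended complex. -/
def extMap {P M Q : Cx.{u, v} R} (f : Hm P M) (h : Hm Q (cone f)) : Hm (ext f h) M where
  f i := LinearMap.coprod (f.f i) (LinearMap.fst R (M.X i) (P.X (i + 1)) ∘ₗ h.f i)
  comm := by
    intro i x
    have t : M.d i (h.f i x.2).1 + f.f (i + 1) (h.f i x.2).2 = (h.f (i + 1) (Q.d i x.2)).1 :=
      congrArg Prod.fst (h.comm i x.2)
    change M.d i (f.f i x.1 + (h.f i x.2).1) =
      f.f (i + 1) (P.d i x.1 - (h.f i x.2).2) + (h.f (i + 1) (Q.d i x.2)).1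
    rw [← t, map_add, map_sub, f.comm]
    abel

lemma transfer (π : R) (a c : ℤ) (k : ℕ) (M C D : Cx.{u, v} R)
    (j : ∀ i, M.X i →ₗ[R] C.X i) (j' : ∀ i, M.X i →ₗ[R] D.X i)
    (φ : ∀ i, C.X i ≃ₗ[R] D.X i) (hφ : ∀ i x, φ (i + 1) (C.d i x) = D.d i (φ i x))
    (hj : ∀ i x, φ i (j i x) = j' i x) (hI : Inv π a c k M C j) : Inv π a c k M D j' := by
  have hz' : ∀ i z, D.d i z = 0 → C.d i ((φ i).symm z) = 0 := by
    intro i z hz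
    apply (φ (i + 1)).injective
    rw [hφ]; simp [hz]
  constructor
  · intro i h1 h2 z hz
    obtain ⟨y, hy⟩ := hI.one i h1 h2 _ (hz' _ _ hz)
    refine ⟨φ i y, ?_⟩
    rw [← hφ, hy]; simp
  · intro i h1 z hz
    obtain ⟨m, y, hm, hy⟩ := hI.two i h1 _ (hz' _ _ hz)
    refine ⟨m, φ i y, hm, ?_⟩
    have := congrArg (φ _) hy
    simpa [hφ, hj] using this
  · intro i h1 m hm y hy
    refine hI.three i h1 m hm ((φ i).symm y) ?_
    apply (φ (i + 1)).injective
    rw [hφ, hj, hy]; simp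

/-- Inclusion in the cone. -/
def inc {P M : Cx.{u, v} R} (f : Hm P M) : Hm M (cone f) where
  f i := LinearMap.inl R _ _
  comm := by
    intro i x
    refine Prod.ext ?_ ?_
    · change M.d i x + f.f _ 0 = M.d i x
      simp
    · change - P.d _ 0 = 0
      simp

/-- Finite free and bounded. -/
structure Good (a b : ℤ) (P : Cx.{u, v} R) : Prop where
  free : ∀ i, Module.Free R (P.X i)
  fin : ∀ i, Module.Finite R (P.X i)
  zero : ∀ i, i < a ∨ b < i → ∀ x : P.X i, x = 0

lemma step (π : R) (a b c : ℤ) (hac : a ≤ c) (k : ℕ) (M P Q : Cx.{u, v} R)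
    (f : Hm P M) (hP : Good a b P) (hQ : Good a b Q)
    (hI : Inv π a c k M (cone f) (inc f).f) (e : ∀ i, Q.X i →ₗ[R] M.X i)
    (hR : Res π a c M Q e) :
    ∃ (P' : Cx.{u, v} R) (f' : Hm P' M), Good a b P' ∧
      Inv π a (c + 1) (k + k * (c - a).toNat + 2) M (cone f') (inc f').f := by
  have := hQ.free
  obtain ⟨h, hh⟩ := exists_lift π a c hac k (cone f) Q hI.one (fun i => inferInstance)
    (fun i hi => hQ.zero i (Or.inl hi)) (fun i => (inc f).f i ∘ₗ e i)
    (fun i hi => by simp [hR.e_zero i hi])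
    (fun i x => by
      rw [LinearMap.comp_apply, (inc f).comm, hR.cyc, map_zero])
    (fun i x => by
      obtain ⟨y, hy⟩ := hR.bd i x
      refine ⟨(inc f).f i y, ?_⟩
      rw [(inc f).comm, hy]; rfl)
  have hS := step_inv π a c hac k M (cone f) Q (inc f) hI e hR h _
    (fun i hi x => by rw [hh i hi]; rfl)
  refine ⟨ext f h, extMap f h, ⟨?_, ?_, ?_⟩, ?_⟩
  · intro i
    have := hP.free i
    have := hQ.free i
    exact inferInstanceAs (Module.Free R (P.X i × Q.X i))
  · intro i
    have := hP.fin i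
    have := hQ.fin i
    exact inferInstanceAs (Module.Finite R (P.X i × Q.X i))
  · intro i hi x
    exact Prod.ext (hP.zero i hi x.1) (hQ.zero i hi x.2)
  · refine transfer π a (c + 1) _ M _ _ _ _
      (fun i => LinearEquiv.prodAssoc R (M.X i) (P.X (i + 1)) (Q.X (i + 1))) ?_ ?_ hS
    · rintro i ⟨⟨m, p⟩, q⟩
      refine Prod.ext ?_ (Prod.ext ?_ ?_)
      · change M.d i m + f.f _ p + (h.f _ q).1 = M.d i m + (f.f _ p + (h.f _ q).1)
        abel
      · change - P.d _ p + (h.f _ q).2 = - (P.d _ p - (h.f _ q).2)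
        abel
      · rfl
    · intro i x
      rfl

/-- The exponents. -/
def expo : ℕ → ℕ
  | 0 => 0
  | n + 1 => expo n + expo n * n + 2

/-- The zero complex. -/
def zeroCx : Cx.{u, v} R where
  X _ := PUnit.{v + 1}
  d _ := 0
  dd _ _ := rfl

lemma main (π : R) (a b : ℤ) (M : Cx.{u, v} R)
    (H : ∀ c, a ≤ c → c ≤ b → ∃ (Q : Cx.{u, v} R) (e : ∀ i, Q.X i →ₗ[R] M.X i),
      Good a b Q ∧ Res π a c M Q e) (n : ℕ) (hn : (n : ℤ) ≤ b - a + 1) :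
    ∃ (P : Cx.{u, v} R) (f : Hm P M), Good a b P ∧
      Inv π a (a + n) (expo n) M (cone f) (inc f).f := by
  induction n with
  | zero =>
    refine ⟨zeroCx, ⟨fun i => 0, by simp⟩, ⟨?_, ?_, ?_⟩, ?_⟩
    · intro i
      exact inferInstanceAs (Module.Free R PUnit.{v + 1})
    · intro i
      exact inferInstanceAs (Module.Finite R PUnit.{v + 1})
    · intro i _ x
      rfl
    · constructor
      · intro i h1 h2
        simp at h2; omega
      · intro i hi z hz
        refine ⟨z.1, 0, ?_, ?_⟩
        · have := congrArg Prod.fst hz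
          change M.d _ z.1 + 0 = 0 at this
          simpa using this
        · simp only [expo, pow_zero, one_smul, map_zero, add_zero]
          rfl
      · intro i hi m hm y hy
        have := congrArg Prod.fst hy
        change m = M.d _ y.1 + 0 at this
        exact ⟨y.1, by simpa using this⟩
  | succ n ih =>
    obtain ⟨P, f, hP, hI⟩ := ih (by push_cast at hn; omega)
    obtain ⟨Q, e, hQ, hR⟩ := H (a + n) (by omega) (by push_cast at hn; omega)
    have := step π a b (a + n) (by omega) _ M P Q f hP hQ hI e hR
    simpa [expo, add_assoc] using this

end Cx

namespace CxHom

variable {R : Type u} [CommRing R]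

section
variable (K : CochainComplex (ModuleCat.{v} R) ℤ) {i j k : ℤ}

lemma exists_cycle (hjk : j + 1 = k) (x : K.X j) (hx : K.d j k x = 0) :
    ∃ z : K.cycles j, K.iCycles j z = x := by
  have hk : (ComplexShape.up ℤ).next j = k := (ComplexShape.up ℤ).next_eq' hjk
  subst hk
  refine ⟨(K.sc j).moduleCatCyclesIso.inv ⟨x, hx⟩, ?_⟩
  have := (K.sc j).moduleCatCyclesIso_inv_iCycles
  exact congrArg (fun g => g.hom ⟨x, hx⟩) this

lemma iCycles_d_apply (z : K.cycles j) : K.d j k (K.iCycles j z) = 0 := by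
  have := K.iCycles_d j k
  exact congrArg (fun g => g.hom z) this

lemma iCycles_inj : Function.Injective (K.iCycles j) :=
  (ModuleCat.mono_iff_injective _).1 inferInstance

lemma homologyπ_surj : Function.Surjective (K.homologyπ j) :=
  (ModuleCat.epi_iff_surjective _).1 inferInstance

lemma homologyπ_zero_iff (hij : i + 1 = j) (z : K.cycles j) :
    K.homologyπ j z = 0 ↔ ∃ y : K.X i, K.iCycles j z = K.d i j y := by
  have hi : (ComplexShape.up ℤ).prev j = i := (ComplexShape.up ℤ).prev_eq' hij
  have ht : ∀ y, K.iCycles j (K.toCycles i j y) = K.d i j y := fun y =>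
    congrArg (fun g => g.hom y) (K.toCycles_i i j)
  constructor
  · intro hz
    have hex := ShortComplex.exact_of_g_is_cokernel
      (ShortComplex.mk (K.toCycles i j) (K.homologyπ j) (by simp)) (K.homologyIsCokernel i j hi)
    rw [ShortComplex.moduleCat_exact_iff] at hex
    obtain ⟨y, hy⟩ := hex z hz
    exact ⟨y, by rw [← ht]; exact congrArg _ hy.symm⟩
  · rintro ⟨y, hy⟩
    rw [← ht] at hy
    rw [iCycles_inj K hy]
    exact congrArg (fun g => g.hom y) (K.toCycles_comp_homologyπ i j)

end

section
variable {P M : CochainComplex (ModuleCat.{v} R) ℤ} (f : P ⟶ M) {i j k : ℤ}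

lemma map_π (z : P.cycles j) : HomologicalComplex.homologyMap f j (P.homologyπ j z) =
    M.homologyπ j (HomologicalComplex.cyclesMap f j z) :=
  congrArg (fun g => g.hom z) (HomologicalComplex.homologyπ_naturality f j)

lemma map_i (z : P.cycles j) : M.iCycles j (HomologicalComplex.cyclesMap f j z) =
    f.f j (P.iCycles j z) :=
  congrArg (fun g => g.hom z) (HomologicalComplex.cyclesMap_i f j)

lemma surj_iff (π : R) (hij : i + 1 = j) (hjk : j + 1 = k) :
    IsPiSurjective π (HomologicalComplex.homologyMap f j) ↔
      ∀ y : M.X j, M.d j k y = 0 → ∃ x : P.X j, P.d j k x = 0 ∧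
        ∃ w : M.X i, π • y = f.f j x + M.d i j w := by
  constructor
  · intro h y hy
    obtain ⟨z, rfl⟩ := exists_cycle M hjk y hy
    obtain ⟨x, hx⟩ := h (M.homologyπ j z)
    obtain ⟨t, rfl⟩ := homologyπ_surj P x
    rw [map_π, ← map_smul, ← sub_eq_zero, ← map_sub, homologyπ_zero_iff M hij] at hx
    obtain ⟨w, hw⟩ := hx
    refine ⟨P.iCycles j t, iCycles_d_apply P t, w, ?_⟩
    rw [← hw, map_sub, map_i, map_smul]
    abel
  · intro h y
    obtain ⟨z, rfl⟩ := homologyπ_surj M y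
    obtain ⟨x, hx, w, hw⟩ := h (M.iCycles j z) (iCycles_d_apply M z)
    obtain ⟨t, rfl⟩ := exists_cycle P hjk x hx
    refine ⟨P.homologyπ j t, ?_⟩
    rw [map_π, ← map_smul, ← sub_eq_zero, ← map_sub, homologyπ_zero_iff M hij]
    refine ⟨w, ?_⟩
    rw [map_sub, map_smul, map_i, hw]
    abel

lemma inj_iff (π : R) (hij : i + 1 = j) (hjk : j + 1 = k) :
    (∀ x, HomologicalComplex.homologyMap f j x = 0 → π • x = 0) ↔
      ∀ x : P.X j, P.d j k x = 0 → ∀ w : M.X i, f.f j x = M.d i j w →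
        ∃ w' : P.X i, π • x = P.d i j w' := by
  constructor
  · intro h x hx w hw
    obtain ⟨z, rfl⟩ := exists_cycle P hjk x hx
    have := h (P.homologyπ j z) (by
      rw [map_π, homologyπ_zero_iff M hij]
      exact ⟨w, by rw [map_i, hw]⟩)
    rw [← map_smul, homologyπ_zero_iff P hij] at this
    obtain ⟨w', hw'⟩ := this
    exact ⟨w', by rw [← hw', map_smul]⟩
  · intro h x hx
    obtain ⟨z, rfl⟩ := homologyπ_surj P x
    rw [map_π, homologyπ_zero_iff M hij] at hx
    obtain ⟨w, hw⟩ := hx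
    obtain ⟨w', hw'⟩ := h (P.iCycles j z) (iCycles_d_apply P z) w (by rw [← hw, map_i])
    rw [← map_smul, homologyπ_zero_iff P hij]
    exact ⟨w', by rw [← hw', map_smul]⟩

end

/-- Unbundle a cochain complex, with a shift of indices. -/
def toCx (K : CochainComplex (ModuleCat.{v} R) ℤ) (c : ℤ) : Cx.{u, v} R where
  X i := K.X (i - c)
  d i := (K.d (i - c) (i + 1 - c)).hom
  dd i x := congrArg (fun g => g.hom x) (K.d_comp_d (i - c) (i + 1 - c) (i + 1 + 1 - c))

/-- Unbundle a cochain complex. -/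
def toCx' (K : CochainComplex (ModuleCat.{v} R) ℤ) : Cx.{u, v} R where
  X i := K.X i
  d i := (K.d i (i + 1)).hom
  dd i x := congrArg (fun g => g.hom x) (K.d_comp_d i (i + 1) (i + 1 + 1))

lemma single_zero (N : ModuleCat.{v} R) (n : ℤ) (hn : n ≠ 0)
    (x : ((HomologicalComplex.single (ModuleCat R) (ComplexShape.up ℤ) 0).obj N).X n) :
    x = 0 := by
  have := HomologicalComplex.isZero_single_obj_X (ComplexShape.up ℤ) 0 N n hn
  have := ModuleCat.subsingleton_of_isZero this
  exact Subsingleton.elim _ _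

lemma single_d (N : ModuleCat.{v} R) (n m : ℤ) 
    (x : ((HomologicalComplex.single (ModuleCat R) (ComplexShape.up ℤ) 0).obj N).X n) :
    ((HomologicalComplex.single (ModuleCat R) (ComplexShape.up ℤ) 0).obj N).d n m x = 0 := by
  simp

lemma res_of (π : R) (a b c : ℤ) (hac : a ≤ c) (M : CochainComplex (ModuleCat.{v} R) ℤ)
    (h : IsPiPseudoCoherent π (a - c) (b - c)
      ((HomologicalComplex.single (ModuleCat R) (ComplexShape.up ℤ) 0).obj (M.homology c))) :
    ∃ (Q : Cx.{u, v} R) (e : ∀ i, Q.X i →ₗ[R] (toCx' M).X i),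
      Cx.Good a b Q ∧ Cx.Res π a c (toCx' M) Q e := by
  obtain ⟨-, Q, f, hfree, hfin, hzero, hiso, hsurj⟩ := h
  have hsurj' : ∀ n, a - c ≤ n → IsPiSurjective π (HomologicalComplex.homologyMap f n) := by
    intro n hn
    rcases hn.eq_or_lt with h | h
    · exact h ▸ hsurj
    · exact (hiso n h).2
  -- the lift in degree `c`
  have hE : ∀ i, ∃ e : Q.X (i - c) →ₗ[R] M.X i, (i ≠ c → e = 0) ∧ (∀ x, M.d i (i + 1) (e x) = 0) ∧
      ∀ hi : i = c, ∃ ψ : ((HomologicalComplex.single (ModuleCat R) (ComplexShape.up ℤ) 0).obj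
        (M.homology c)).X (i - c) ≃ₗ[R] M.homology i, 
        ∀ x, ∃ z : M.cycles i, M.iCycles i z = e x ∧ M.homologyπ i z = ψ (f.f (i - c) x) := by
    intro i
    by_cases hi : i = c
    · subst hi
      let ψ := (HomologicalComplex.singleObjXIsoOfEq (ComplexShape.up ℤ) 0 (M.homology i) (i - i)
        (by omega)).toLinearEquiv
      have := hfree (i - i)
      obtain ⟨l, hl⟩ := Cx.proj_lift (M.homologyπ i).hom (ψ.toLinearMap ∘ₗ (f.f (i - i)).hom)
        (fun x => homologyπ_surj M _)
      refine ⟨(M.iCycles i).hom ∘ₗ l, fun h => (h rfl).elim, fun x => iCycles_d_apply M _,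
        fun _ => ⟨ψ, fun x => ⟨l x, rfl, hl x⟩⟩⟩
    · exact ⟨0, fun _ => rfl, fun x => by simp, fun h => (hi h).elim⟩
  choose e he0 hecyc hψ using hE
  refine ⟨toCx Q c, e, ⟨fun i => hfree _, fun i => hfin _, fun i hi => hzero _ (by omega)⟩,
    ⟨he0, hecyc, ?_, ?_, ?_, ?_⟩⟩
  · intro i x
    by_cases hi : i + 1 = c
    · obtain ⟨ψ, hz⟩ := hψ (i + 1) hi
      obtain ⟨z, hz1, hz2⟩ := hz (Q.d (i - c) (i + 1 - c) x)
      have h0 : f.f (i + 1 - c) (Q.d (i - c) (i + 1 - c) x) = 0 := by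
        have := congrArg (fun g => g.hom x) (f.comm (i - c) (i + 1 - c))
        refine Eq.trans this.symm ?_
        exact single_d _ _ _ _
      rw [h0, map_zero, homologyπ_zero_iff M (i := i) rfl] at hz2
      obtain ⟨y, hy⟩ := hz2
      exact ⟨y, by rw [hz1] at hy; exact hy.symm⟩
    · refine ⟨0, (map_zero _).trans ?_⟩
      rw [he0 (i + 1) hi]; rfl
  · intro i hi m hm
    obtain ⟨ψ, hz⟩ := hψ (i + 1) hi
    obtain ⟨t, ht⟩ := exists_cycle M rfl m hm
    obtain ⟨x, hx, w, hw⟩ := (surj_iff f π (i := i - c) (j := i + 1 - c) (k := i + 1 + 1 - c)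
      (by omega) (by omega)).1 (hsurj' _ (by omega)) (ψ.symm (M.homologyπ (i + 1) t))
      (single_d _ _ _ _)
    rw [single_d, add_zero] at hw
    obtain ⟨z, hz1, hz2⟩ := hz x
    have : M.homologyπ (i + 1) (π • t - z) = 0 := by
      rw [map_sub, map_smul, hz2, ← hw]; simp
    rw [homologyπ_zero_iff M (i := i) rfl] at this
    obtain ⟨y, hy⟩ := this
    refine ⟨x, y, hx, ?_⟩
    rw [map_sub, map_smul, ht, hz1] at hy
    exact (sub_eq_iff_eq_add'.1 hy)
  · rintro i hi ha q hq ⟨y, hy⟩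
    obtain ⟨ψ, hz⟩ := hψ (i + 1) hi
    obtain ⟨z, hz1, hz2⟩ := hz q
    refine (inj_iff f π (i := i - c) (j := i + 1 - c) (k := i + 1 + 1 - c)
      (by omega) (by omega)).1 (hiso _ (by omega)).1 q hq 0 ?_
    rw [map_zero]
    apply ψ.injective
    rw [map_zero, ← hz2, homologyπ_zero_iff M (i := i) rfl]
    exact ⟨y, by rw [hz1]; exact hy⟩
  · intro i hi ha q hq
    refine (inj_iff f π (i := i - c) (j := i + 1 - c) (k := i + 1 + 1 - c)
      (by omega) (by omega)).1 (hiso _ (by omega)).1 q hq 0 ?_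
    rw [single_zero _ _ (by omega) (f.f _ q), map_zero]

/-- Bundle a complex. -/
noncomputable def ofCx (P : Cx.{u, v} R) : CochainComplex (ModuleCat.{v} R) ℤ :=
  CochainComplex.of (fun i => ModuleCat.of R (P.X i)) (fun i => ModuleCat.ofHom (P.d i))
    (fun i => by ext x; exact P.dd i x)

lemma ofCx_d (P : Cx.{u, v} R) (i : ℤ) (x : P.X i) : (ofCx P).d i (i + 1) x = P.d i x := by
  have : (ofCx P).d i (i + 1) = ModuleCat.ofHom (P.d i) := 
    CochainComplex.of_d (fun i => ModuleCat.of R (P.X i)) (fun i => ModuleCat.ofHom (P.d i)) i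
  rw [this]; rfl

/-- Bundle a chain map. -/
noncomputable def ofHm (P : Cx.{u, v} R) (M : CochainComplex (ModuleCat.{v} R) ℤ)
    (f : Cx.Hm P (toCx' M)) : ofCx P ⟶ M where
  f i := ModuleCat.ofHom (f.f i)
  comm' := by
    rintro i j hij
    obtain rfl : i + 1 = j := hij
    ext x
    exact (f.comm i x).trans (congrArg (f.f (i + 1)) (ofCx_d P i x).symm)

lemma final (π : R) (a b : ℤ) (hab : a ≤ b) (M : CochainComplex (ModuleCat.{v} R) ℤ)
    (hM : ∀ i : ℤ, b < i → ∀ x : M.X i, x = 0) (k : ℕ)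
    (P : Cx.{u, v} R) (f : Cx.Hm P (toCx' M)) (hP : Cx.Good a b P)
    (hI : Cx.Inv π a (b + 1) k (toCx' M) (Cx.cone f) (Cx.inc f).f) :
    IsPiPseudoCoherent (π ^ k) a b M := by
  have key : ∀ i, a ≤ i + 1 → ∀ z : (Cx.cone f).X (i + 1), (Cx.cone f).d _ z = 0 →
      ∃ y, (Cx.cone f).d i y = π ^ k • z := by
    intro i hi z hz
    by_cases hb : i + 1 < b + 1
    · exact hI.one i hi hb z hz
    · obtain ⟨m, y, hm, hy⟩ := hI.two i (by omega) z hz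
      have : m = 0 := hM (i + 1) (by omega) m
      rw [this, map_zero, zero_add] at hy
      exact ⟨y, hy.symm⟩
  have hs : ∀ i, a ≤ i → IsPiSurjective (π ^ k) (HomologicalComplex.homologyMap (ofHm P M f) i) := by
    intro i hi
    obtain ⟨i, rfl⟩ : ∃ t, i = t + 1 := ⟨i - 1, by omega⟩
    rw [surj_iff _ _ rfl rfl]
    intro y hy
    obtain ⟨⟨m, p⟩, hz⟩ := key i hi (Cx.mkc f (i + 1) y 0) (by
      refine Prod.ext ?_ ?_
      · change (toCx' M).d (i + 1) y + f.f _ 0 = 0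
        rw [map_zero, add_zero]
        exact hy
      · change - P.d _ 0 = 0
        simp)
    have h1 : (toCx' M).d i m + f.f _ p = π ^ k • (show (toCx' M).X (i + 1) from y) :=
      congrArg Prod.fst hz
    have h2 : - P.d _ p = π ^ k • 0 := congrArg Prod.snd hz
    have h3 : P.d _ p = 0 := by simpa using h2
    refine ⟨p, ?_, m, ?_⟩
    · exact (ofCx_d P _ _).trans h3
    · exact h1.symm.trans (add_comm _ _)
  refine ⟨hM, ofCx P, ofHm P M f, fun i => hP.free i, fun i => hP.fin i, fun i hi => hP.zero i hi,
    fun i hi => ⟨?_, hs i hi.le⟩, hs a le_rfl⟩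
  obtain ⟨i, rfl⟩ : ∃ t, i = t + 1 + 1 := ⟨i - 2, by omega⟩
  rw [inj_iff _ _ rfl rfl]
  intro x hx w hw
  have hx' : P.d _ x = 0 := (ofCx_d P _ _).symm.trans hx
  have hw' : f.f _ x = (toCx' M).d (i + 1) w := hw
  obtain ⟨⟨m, p⟩, hz⟩ := key i (by omega) (Cx.mkc f (i + 1) (-w) x) (by
      refine Prod.ext ?_ ?_
      · change (toCx' M).d (i + 1) (-(show (toCx' M).X (i + 1) from w)) + f.f _ x = 0
        rw [hw', map_neg]; exact neg_add_cancel _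
      · change - P.d _ x = 0
        rw [hx', neg_zero])
  have h2 : - P.d _ p = π ^ k • x := congrArg Prod.snd hz
  rw [← map_neg] at h2
  exact ⟨-p, h2.symm.trans (ofCx_d P _ _).symm⟩

end CxHom

/-- **Corollary 4.8.** There is an integer `l ≥ 0` depending only on `b - a` such that: for
every commutative ring `R`, every `π ∈ R`, and every cochain complex `M^•` of `R`-modules
vanishing in degrees `> b` such that, for every `i ∈ [a,b]`, the cohomology module
`H^i(M^•)` (viewed as a complex concentrated in degree `0`) is
`π`-`[a-i,b-i]`-pseudo-coherent, the complex `M^•` is `π^l`-`[a,b]`-pseudo-coherent. -/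
theorem isPiPseudoCoherent_of_pseudoCoherent_homology :
    ∃ l : ℤ → ℕ, ∀ (a b : ℤ), a ≤ b →
      ∀ (R : Type u) [CommRing R] (π : R) (M : CochainComplex (ModuleCat R) ℤ),
        (∀ i : ℤ, b < i → ∀ x : M.X i, x = 0) →
        (∀ i : ℤ, a ≤ i → i ≤ b →
          IsPiPseudoCoherent π (a - i) (b - i)
            ((HomologicalComplex.single (ModuleCat R) (ComplexShape.up ℤ) 0).obj
              (M.homology i))) →
        IsPiPseudoCoherent (π ^ l (b - a)) a b M := by

  refine ⟨fun n => Cx.expo (n + 1).toNat, ?_⟩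
  intro a b hab R _ π M hM h
  obtain ⟨P, f, hP, hI⟩ := Cx.main π a b (CxHom.toCx' M)
    (fun c hac hcb => CxHom.res_of π a b c hac M (h c hac hcb)) (b - a + 1).toNat (by omega)
  have hb : a + ((b - a + 1).toNat : ℤ) = b + 1 := by omega
  rw [hb] at hI
  exact CxHom.final π a b hab M hM _ P f hP hI
end

section
/- Let R be a Noetherian commutative ring, π ∈ R, and M an R-module. (1) If M is of π-finite type, then for all integers a ≤ 0 ≤ b the complex M[0] concentrated in degree 0 is π-[a,b]-pseudo-coherent; conversely, if M[0] is π-[a,b]-pseudo-coherent for some integers a ≤ 0 ≤ b, then M is of π-finite type. (2) If M is of π-finite type, then every subquotient of M is of π-finite type; conversely, if M admits a finite filtration of length l by submodules whose successive graded pieces are all of π-finite type, then M is of π^l-finite type. -/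
open CategoryTheory

/-- An `R`-module `M` is of `π`-finite type if there is an `R`-linear map `R^n → M` whose
cokernel is annihilated by `π`. -/
def IsPiFiniteType {R : Type*} [CommRing R] (π : R) (M : Type*) [AddCommGroup M]
    [Module R M] : Prop :=
  ∃ (n : ℕ) (f : (Fin n → R) →ₗ[R] M), ∀ m : M, π • m ∈ LinearMap.range f

universe u

theorem piFT_of_fg {R : Type*} [CommRing R] {π : R} {M : Type*} [AddCommGroup M] [Module R M]
    (N : Submodule R M) (hN : N.FG) (h : ∀ m : M, π • m ∈ N) : IsPiFiniteType π M := by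
  obtain ⟨n, f, hf⟩ := (Submodule.fg_iff_exists_fin_linearMap _ _).1 hN
  exact ⟨n, f, fun m => by rw [hf]; exact h m⟩

theorem piFT_subquotient {R : Type*} [CommRing R] [IsNoetherianRing R] {π : R} {M : Type*}
    [AddCommGroup M] [Module R M] (h : IsPiFiniteType π M)
    (N : Submodule R M) (Q : Submodule R ↥N) : IsPiFiniteType π (↥N ⧸ Q) := by
  obtain ⟨n, f, hf⟩ := h
  have : IsNoetherian R (LinearMap.range f) := inferInstance
  let g : N →ₗ[R] LinearMap.range f :=
    LinearMap.codRestrict _ ((LinearMap.lsmul R M π).comp N.subtype) (fun x => hf x)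
  -- `π N` is finitely generated
  have h1 : (LinearMap.range (LinearMap.lsmul R N π)).FG := by
    let j : LinearMap.range (LinearMap.lsmul R N π) →ₗ[R] LinearMap.range f :=
      LinearMap.codRestrict _ (N.subtype.comp (Submodule.subtype _)) (by
        rintro ⟨_, ⟨x, rfl⟩⟩
        exact hf x)
    have hj : Function.Injective j := by
      intro x y hxy
      have := congrArg Subtype.val hxy
      exact Subtype.ext (Subtype.ext this)
    have : IsNoetherian R (LinearMap.range (LinearMap.lsmul R N π)) :=
      isNoetherian_of_injective j hj
    exact Module.Finite.iff_fg.1 inferInstance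
  refine piFT_of_fg _ (h1.map Q.mkQ) ?_
  intro m
  obtain ⟨x, rfl⟩ := Q.mkQ_surjective m
  exact ⟨π • x, ⟨x, rfl⟩, by simp⟩

theorem piFT_filtration {R : Type*} [CommRing R] {π : R} {M : Type*}
    [AddCommGroup M] [Module R M] (l : ℕ) (F : Fin (l + 1) → Submodule R M)
    (h0 : F 0 = ⊥) (h1 : F (Fin.last l) = ⊤)
    (h : ∀ i : Fin l, IsPiFiniteType π
        (↥(F i.succ) ⧸ Submodule.comap (F i.succ).subtype (F i.castSucc))) :
    IsPiFiniteType (π ^ l) M := by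
  have key : ∀ i : Fin (l + 1), ∃ N : Submodule R M, N.FG ∧ ∀ x ∈ F i, π ^ (i : ℕ) • x ∈ N := by
    intro i
    induction i using Fin.induction with
    | zero => exact ⟨⊥, Submodule.fg_bot, by simp [h0]⟩
    | succ i ih =>
      obtain ⟨N, hN, hx⟩ := ih
      obtain ⟨n, f, hf⟩ := h i
      obtain ⟨g, hg⟩ := Module.projective_lifting_property
        (Submodule.mkQ (Submodule.comap (F i.succ).subtype (F i.castSucc))) f
        (Submodule.mkQ_surjective _)
      refine ⟨LinearMap.range ((F i.succ).subtype.comp g) ⊔ N, Submodule.FG.sup ?_ hN, ?_⟩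
      · exact Module.Finite.iff_fg.1 inferInstance
      · intro x hxF
        obtain ⟨v, hv⟩ := hf (Submodule.Quotient.mk ⟨x, hxF⟩)
        rw [← hg] at hv
        have hv' : π • (⟨x, hxF⟩ : F i.succ) - g v ∈
            Submodule.comap (F i.succ).subtype (F i.castSucc) := by
          rw [← Submodule.Quotient.eq]
          exact hv.symm
        have hz : π • x - (g v : M) ∈ F i.castSucc := hv'
        have h3 := hx _ hz
        have h4 : π ^ ((i.succ : Fin (l + 1)) : ℕ) • x =
            π ^ (i : ℕ) • (g v : M) + π ^ (i : ℕ) • (π • x - (g v : M)) := by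
          rw [← smul_add, add_sub_cancel, smul_smul, Fin.val_succ, pow_succ]
        rw [h4]
        refine Submodule.add_mem_sup (Submodule.smul_mem _ _ ⟨v, rfl⟩) h3
  obtain ⟨N, hN, hx⟩ := key (Fin.last l)
  exact piFT_of_fg N hN (fun m => hx m (by rw [h1]; trivial))

theorem exists_trunc_seq {R : Type*} [CommRing R] [IsNoetherianRing R] {M : Type*}
    [AddCommGroup M] [Module R M] (N k0 : ℕ) (f : (Fin k0 → R) →ₗ[R] M) :
    ∃ (k : ℕ → ℕ) (d : ∀ n, (Fin (k (n + 1)) → R) →ₗ[R] (Fin (k n) → R))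
      (g : (Fin (k 0) → R) →ₗ[R] M), LinearMap.range g = LinearMap.range f ∧
      (∀ x, g (d 0 x) = 0) ∧ (0 < N → ∀ x, g x = 0 → ∃ y, d 0 y = x) ∧
      (∀ n x, d n (d (n + 1) x) = 0) ∧
      (∀ n, n + 1 < N → ∀ x, d n x = 0 → ∃ y, d (n + 1) y = x) ∧
      (∀ n, N < n → k n = 0) := by
  have H : ∀ (n : ℕ) (s : Σ k : ℕ, Submodule R (Fin k → R)),
      ∃ (s' : Σ k : ℕ, Submodule R (Fin k → R)) (d : (Fin s'.1 → R) →ₗ[R] (Fin s.1 → R)),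
        s'.2 = LinearMap.ker d ∧ LinearMap.range d ≤ s.2 ∧
        (n < N → s.2 ≤ LinearMap.range d) ∧ (N ≤ n → s'.1 = 0) := by
    intro n s
    by_cases hn : n < N
    · obtain ⟨k', d, hd⟩ := (Submodule.fg_iff_exists_fin_linearMap _ _).1 (IsNoetherian.noetherian s.2)
      exact ⟨⟨k', LinearMap.ker d⟩, d, rfl, hd.le, fun _ => hd.ge, fun h => by omega⟩
    · exact ⟨⟨0, LinearMap.ker (0 : (Fin 0 → R) →ₗ[R] (Fin s.1 → R))⟩, 0, rfl, by simp,
        fun h => absurd h hn, fun _ => rfl⟩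
  choose nxt d h1 h2 h3 h4 using H
  let st : ℕ → Σ k : ℕ, Submodule R (Fin k → R) :=
    fun n => Nat.rec ⟨k0, LinearMap.ker f⟩ nxt n
  refine ⟨fun n => (st n).1, fun n => d n (st n), f, rfl, ?_, ?_, ?_, ?_, ?_⟩
  · intro x
    exact h2 0 (st 0) ⟨x, rfl⟩
  · intro hN x hx
    exact h3 0 (st 0) hN hx
  · intro n x
    have := h2 (n + 1) (st (n + 1)) ⟨x, rfl⟩
    rw [show (st (n + 1)).2 = _ from h1 n (st n)] at this
    exact this
  · intro n hn x hx
    apply h3 (n + 1) (st (n + 1)) hn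
    rw [show (st (n + 1)).2 = _ from h1 n (st n)]
    exact hx
  · intro n hn
    obtain ⟨m, rfl⟩ : ∃ m, n = m + 1 := ⟨n - 1, by omega⟩
    exact h4 m (st m) (by omega)

section Single

open HomologicalComplex

variable {R : Type u} [CommRing R]

theorem single_formula {P : CochainComplex (ModuleCat.{u} R) ℤ} {A : ModuleCat.{u} R}
    (φ : P ⟶ (single (ModuleCat R) (ComplexShape.up ℤ) 0).obj A) :
    P.homologyπ 0 ≫ homologyMap φ 0 ≫ (singleObjHomologySelfIso _ 0 A).hom =
      P.iCycles 0 ≫ φ.f 0 ≫ (singleObjXSelf _ 0 A).hom := by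
  rw [homologyπ_naturality_assoc, homologyπ_singleObjHomologySelfIso_hom,
    singleObjCyclesSelfIso_hom, cyclesMap_i_assoc]

theorem homologyπ_surj (P : CochainComplex (ModuleCat.{u} R) ℤ) (i : ℤ) :
    Function.Surjective (P.homologyπ i) :=
  (ModuleCat.epi_iff_surjective _).1 inferInstance

theorem piIso_of_isZero (π : R) {A B : ModuleCat.{u} R} (f : A ⟶ B) (hA : Limits.IsZero A)
    (hB : Limits.IsZero B) : IsPiIsomorphism π f := by
  have := ModuleCat.subsingleton_of_isZero hA
  have := ModuleCat.subsingleton_of_isZero hB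
  exact ⟨fun x _ => Subsingleton.elim _ _, fun y => ⟨0, Subsingleton.elim _ _⟩⟩

theorem single_piSurj (π : R) {P : CochainComplex (ModuleCat.{u} R) ℤ} {A : ModuleCat.{u} R}
    (φ : P ⟶ (single (ModuleCat R) (ComplexShape.up ℤ) 0).obj A)
    (hd : P.d 0 1 = 0)
    (h : ∀ y : A, ∃ x : P.X 0, π • y = (φ.f 0 ≫ (singleObjXSelf _ 0 A).hom) x) :
    IsPiSurjective π (homologyMap φ 0) := by
  intro y
  obtain ⟨x, hx⟩ := h ((singleObjHomologySelfIso _ 0 A).hom y)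
  have : IsIso (P.iCycles 0) := P.isIso_iCycles 0 1 (by simp) hd
  obtain ⟨z, rfl⟩ := ((ModuleCat.epi_iff_surjective (P.iCycles 0)).1 inferInstance) x
  refine ⟨P.homologyπ 0 z, ?_⟩
  apply ((ModuleCat.mono_iff_injective (singleObjHomologySelfIso _ 0 A).hom).1 inferInstance)
  have h1 := ConcreteCategory.congr_hom (single_formula φ) z
  rw [map_smul, hx]
  exact h1.symm

theorem single_inj {P : CochainComplex (ModuleCat.{u} R) ℤ} {A : ModuleCat.{u} R}
    (φ : P ⟶ (single (ModuleCat R) (ComplexShape.up ℤ) 0).obj A)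
    (h : ∀ x : P.X 0, (φ.f 0 ≫ (singleObjXSelf _ 0 A).hom) x = 0 →
      ∃ w : P.X (-1), P.d (-1) 0 w = x)
    (y : P.homology 0) (hy : homologyMap φ 0 y = 0) : y = 0 := by
  obtain ⟨z, rfl⟩ := homologyπ_surj P 0 y
  have h1 := ConcreteCategory.congr_hom (single_formula φ) z
  have h2 : (φ.f 0 ≫ (singleObjXSelf _ 0 A).hom) (P.iCycles 0 z) = 0 := by
    refine Eq.trans h1.symm ?_
    change (singleObjHomologySelfIso _ 0 A).hom (homologyMap φ 0 (P.homologyπ 0 z)) = 0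
    rw [hy, map_zero]
  obtain ⟨w, hw⟩ := h _ h2
  have h3 : P.toCycles (-1) 0 w = z := by
    apply ((ModuleCat.mono_iff_injective (P.iCycles 0)).1 inferInstance)
    rw [← hw]
    exact ConcreteCategory.congr_hom (P.toCycles_i (-1) 0) w
  rw [← h3]
  exact ConcreteCategory.congr_hom (P.toCycles_comp_homologyπ (-1) 0) w

theorem piFT_of_pseudoCoherent [IsNoetherianRing R] (π : R) (A : ModuleCat.{u} R) (a b : ℤ)
    (ha : a ≤ 0)
    (h : IsPiPseudoCoherent π a b ((single (ModuleCat R) (ComplexShape.up ℤ) 0).obj A)) :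
    IsPiFiniteType π A := by
  obtain ⟨-, P, φ, -, hfin, -, hiso, hsurj⟩ := h
  have hs : IsPiSurjective π (homologyMap φ 0) := by
    rcases ha.lt_or_eq with h | rfl
    · exact (hiso 0 h).2
    · exact hsurj
  have := hfin 0
  have hc : Module.Finite R (P.cycles 0) :=
    Module.Finite.of_injective (P.iCycles 0).hom
      ((ModuleCat.mono_iff_injective (P.iCycles 0)).1 inferInstance)
  have hh : Module.Finite R (P.homology 0) :=
    Module.Finite.of_surjective (P.homologyπ 0).hom (homologyπ_surj P 0)
  let g : P.homology 0 ⟶ A := homologyMap φ 0 ≫ (singleObjHomologySelfIso _ 0 A).hom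
  refine piFT_of_fg (LinearMap.range g.hom) (Module.Finite.iff_fg.1 inferInstance) ?_
  intro m
  obtain ⟨y, rfl⟩ := ((ModuleCat.epi_iff_surjective
    (singleObjHomologySelfIso (ComplexShape.up ℤ) 0 A).hom).1 inferInstance) m
  obtain ⟨x, hx⟩ := hs y
  refine ⟨x, ?_⟩
  change (singleObjHomologySelfIso _ 0 A).hom (homologyMap φ 0 x) = _
  rw [← hx, map_smul]

theorem pseudoCoherent_of_piFT [IsNoetherianRing R] (π : R) (M : Type u) [AddCommGroup M]
    [Module R M] (hM : IsPiFiniteType π M) (a b : ℤ) (ha : a ≤ 0) (hb : 0 ≤ b) :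
    IsPiPseudoCoherent π a b
      ((single (ModuleCat R) (ComplexShape.up ℤ) 0).obj (ModuleCat.of R M)) := by
  obtain ⟨k0, f, hf⟩ := hM
  obtain ⟨k, d, g, hg, hgd, hg0, hdd, hex, hk⟩ := exists_trunc_seq (-a).toNat k0 f
  have hz : ∀ i : ℤ, i ≠ 0 → Limits.IsZero
      (((single (ModuleCat R) (ComplexShape.up ℤ) 0).obj (ModuleCat.of R M)).homology i) :=
    fun i hi => (exactAt_iff_isZero_homology _ _).1 (exactAt_single_obj _ _ _ _ hi)
  refine ⟨?_, ?_⟩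
  · intro i hi x
    have := ModuleCat.subsingleton_of_isZero (isZero_single_obj_X (ComplexShape.up ℤ) 0
      (ModuleCat.of R M) i (by omega))
    exact Subsingleton.elim _ _
  let K : ChainComplex (ModuleCat.{u} R) ℕ :=
    ChainComplex.of (fun n => ModuleCat.of R (Fin (k n) → R)) (fun n => ModuleCat.ofHom (d n))
      (fun n => by ext1; exact LinearMap.ext (hdd n))
  have hKd : ∀ n, K.d (n + 1) n = ModuleCat.ofHom (d n) := fun n =>
    ChainComplex.of_d (fun n => ModuleCat.of R (Fin (k n) → R)) (fun n => ModuleCat.ofHom (d n)) n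
  let e := ComplexShape.embeddingDownNat
  let P := K.extend e
  have he : ∀ n : ℕ, e.f n = -(n : ℤ) := fun n => rfl
  have he0 : e.f 0 = 0 := rfl
  have he1 : e.f 1 = -1 := rfl
  have hpos : ∀ i : ℤ, 0 < i → ∀ n, e.f n ≠ i := by
    intro i hi n; rw [he]; omega
  have hneg : ∀ i : ℤ, i ≤ 0 → ∃ n : ℕ, e.f n = i := by
    intro i hi; exact ⟨(-i).toNat, by rw [he]; omega⟩
  have hPpos : ∀ i : ℤ, 0 < i → Subsingleton (P.X i) := fun i hi =>
    ModuleCat.subsingleton_of_isZero (K.isZero_extend_X e i (hpos i hi))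
  have hPd : P.d (-1) 0 = (K.extendXIso e he1).hom ≫ ModuleCat.ofHom (d 0) ≫
      (K.extendXIso e he0).inv := by
    rw [← hKd 0]; exact K.extend_d_eq e he1 he0
  let g' : K.X 0 ⟶ ModuleCat.of R M := ModuleCat.ofHom g
  let φ : P ⟶ (single (ModuleCat R) (ComplexShape.up ℤ) 0).obj (ModuleCat.of R M) :=
    mkHomToSingle ((K.extendXIso e he0).hom ≫ g') (by
      intro i hi
      obtain rfl : i = -1 := by
        have : i + 1 = 0 := hi
        omega
      rw [hPd]
      simp only [Category.assoc, Iso.inv_hom_id_assoc]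
      have : ModuleCat.ofHom (d 0) ≫ g' = 0 := by
        ext1; exact LinearMap.ext hgd
      rw [this, Limits.comp_zero])
  have hφ : φ.f 0 ≫ (singleObjXSelf (ComplexShape.up ℤ) 0 (ModuleCat.of R M)).hom =
      (K.extendXIso e he0).hom ≫ g' := by
    simp only [φ, mkHomToSingle_f, Category.assoc, Iso.inv_hom_id, Category.comp_id]
  have hsurj : IsPiSurjective π (homologyMap φ 0) := by
    apply single_piSurj
    · have := hPpos 1 one_pos
      ext x
      exact Subsingleton.elim _ _
    · intro y
      have := hf y
      rw [← hg] at this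
      obtain ⟨x, hx⟩ := this
      refine ⟨(K.extendXIso e he0).inv x, ?_⟩
      rw [hφ, ← hx]
      change g x = g ((K.extendXIso e he0).hom ((K.extendXIso e he0).inv x))
      congr 1
      exact (ConcreteCategory.congr_hom (K.extendXIso e he0).inv_hom_id x).symm
  refine ⟨P, φ, ?_, ?_, ?_, ?_, ?_⟩
  · intro i
    rcases lt_or_ge 0 i with hi | hi
    · have := hPpos i hi
      infer_instance
    · obtain ⟨n, hn⟩ := hneg i hi
      have : Module.Free R (K.X n) := inferInstanceAs (Module.Free R (Fin (k n) → R))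
      exact Module.Free.of_equiv (K.extendXIso e hn).toLinearEquiv.symm
  · intro i
    rcases lt_or_ge 0 i with hi | hi
    · have := hPpos i hi
      infer_instance
    · obtain ⟨n, hn⟩ := hneg i hi
      have : Module.Finite R (K.X n) := inferInstanceAs (Module.Finite R (Fin (k n) → R))
      exact Module.Finite.equiv (K.extendXIso e hn).toLinearEquiv.symm
  · intro i hi x
    rcases lt_or_ge 0 i with hi' | hi'
    · have := hPpos i hi'
      exact Subsingleton.elim _ _
    · obtain ⟨n, hn⟩ := hneg i hi'
      have hn' := he n
      have hkn : k n = 0 := hk n (by omega)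
      have : Subsingleton (K.X n) := by
        change Subsingleton (Fin (k n) → R)
        rw [hkn]; infer_instance
      apply (K.extendXIso e hn).toLinearEquiv.injective
      exact Subsingleton.elim _ _
  · intro i hi
    rcases lt_trichotomy i 0 with h | rfl | h
    · refine piIso_of_isZero π _ ?_ (hz i h.ne)
      rw [← exactAt_iff_isZero_homology]
      obtain ⟨n, hn⟩ := hneg i h.le
      have hn' := he n
      obtain ⟨m, rfl⟩ : ∃ m, n = m + 1 := ⟨n - 1, by omega⟩
      refine (K.extend_exactAt_iff e hn).2 ?_
      rw [K.exactAt_iff' (m + 2) (m + 1) m (by simp) (by simp), ShortComplex.moduleCat_exact_iff]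
      intro x hx
      change K.d (m + 1) m x = 0 at hx
      rw [hKd] at hx
      obtain ⟨y, hy⟩ := hex m (by omega) x hx
      refine ⟨y, ?_⟩
      change K.d (m + 1 + 1) (m + 1) y = x
      rw [hKd]
      exact hy
    · refine ⟨fun y hy => ?_, hsurj⟩
      rw [single_inj φ ?_ y hy, smul_zero]
      intro x hx
      rw [hφ] at hx
      obtain ⟨w, hw⟩ := hg0 (by omega) _ hx
      refine ⟨(K.extendXIso e he1).inv w, ?_⟩
      rw [hPd]
      change (K.extendXIso e he0).inv (d 0 ((K.extendXIso e he1).hom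
        ((K.extendXIso e he1).inv w))) = x
      have h1 : (K.extendXIso e he1).hom ((K.extendXIso e he1).inv w) = w :=
        ConcreteCategory.congr_hom (K.extendXIso e he1).inv_hom_id w
      rw [h1, hw]
      exact ConcreteCategory.congr_hom (K.extendXIso e he0).hom_inv_id x
    · refine piIso_of_isZero π _ ?_ (hz i h.ne')
      rw [← exactAt_iff_isZero_homology]
      exact K.extend_exactAt e i (hpos i h)
  · rcases ha.lt_or_eq with h | rfl
    · have := ModuleCat.subsingleton_of_isZero (hz a h.ne)
      exact fun y => ⟨0, Subsingleton.elim _ _⟩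
    · exact hsurj

end Single

/-- **Lemma 4.12.** Let `R` be a Noetherian commutative ring, `π ∈ R` and `M` an `R`-module.
(1) If `M` is of `π`-finite type then `M[0]` is `π`-`[a,b]`-pseudo-coherent for all
`a ≤ 0 ≤ b`; conversely if `M[0]` is `π`-`[a,b]`-pseudo-coherent for some `a ≤ 0 ≤ b` then
`M` is of `π`-finite type.
(2) If `M` is of `π`-finite type then so are its subquotients; conversely, if `M` admits a
finite filtration of length `l` whose graded pieces are of `π`-finite type, then `M` is of
`π^l`-finite type. -/
theorem isPiFiniteType_noetherian {R : Type u} [CommRing R] [IsNoetherianRing R] (π : R)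
    (M : Type u) [AddCommGroup M] [Module R M] :
    (IsPiFiniteType π M → ∀ a b : ℤ, a ≤ 0 → 0 ≤ b →
      IsPiPseudoCoherent π a b
        ((HomologicalComplex.single (ModuleCat R) (ComplexShape.up ℤ) 0).obj
          (ModuleCat.of R M))) ∧
    ((∃ a b : ℤ, a ≤ 0 ∧ 0 ≤ b ∧
      IsPiPseudoCoherent π a b
        ((HomologicalComplex.single (ModuleCat R) (ComplexShape.up ℤ) 0).obj
          (ModuleCat.of R M))) → IsPiFiniteType π M) ∧
    (IsPiFiniteType π M →
      ∀ (N : Submodule R M) (Q : Submodule R ↥N), IsPiFiniteType π (↥N ⧸ Q)) ∧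
    (∀ (l : ℕ) (F : Fin (l + 1) → Submodule R M), Monotone F → F 0 = ⊥ →
      F (Fin.last l) = ⊤ →
      (∀ i : Fin l, IsPiFiniteType π
        (↥(F i.succ) ⧸ Submodule.comap (F i.succ).subtype (F i.castSucc))) →
      IsPiFiniteType (π ^ l) M) := by
  refine ⟨fun h a b ha hb => pseudoCoherent_of_piFT π M h a b ha hb, ?_,
    fun h N Q => piFT_subquotient h N Q, fun l F _ h0 h1 h => piFT_filtration l F h0 h1 h⟩
  rintro ⟨a, b, ha, -, h⟩
  exact piFT_of_pseudoCoherent π (ModuleCat.of R M) a b ha h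
end
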